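/- arXiv:1710.08811 — 2 statements merged into one kernel-verified Lean document; each statement's English description precedes it below -/
import Mathlib

section
/- There exist C₀ > 0 and γ₀ > 0 such that for every γ ≥ γ₀, every μ > 0, and every smooth B : [0,∞) → ℝ satisfying B(0) = γ, B'(0) = 0 and B''(r) + B'(r)/r = −μ⁻² γ⁻² B(r) e^{B(r)² − γ²} for r > 0 (i.e. ΔB = μ⁻²γ⁻² B e^{B²−γ²} radially, with Δ = -(∂²/∂x²+∂²/∂y²)), setting t(r) = ln(1 + r²/(4μ²)), one has |B(r) − γ + t(r)/γ + t(r)/γ³| ≤ C₀ γ⁻² for all r ≥ 0 with t(r) ≤ γ². -/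
open Set Filter Topology Real

noncomputable section

/-- Comparison of increments from a pointwise comparison of derivatives. -/
theorem sub_le_sub_of_hasDerivAt_le {f g f' g' : ℝ → ℝ} {a b : ℝ} (hab : a ≤ b)
    (hf : ContinuousOn f (Icc a b)) (hg : ContinuousOn g (Icc a b))
    (hf' : ∀ x ∈ Ioo a b, HasDerivAt f (f' x) x) (hg' : ∀ x ∈ Ioo a b, HasDerivAt g (g' x) x)
    (h : ∀ x ∈ Ioo a b, f' x ≤ g' x) : f b - f a ≤ g b - g a := by
  have hmono : MonotoneOn (fun x => g x - f x) (Icc a b) := by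
    apply monotoneOn_of_deriv_nonneg (convex_Icc a b) (hg.sub hf)
    · rw [interior_Icc]
      exact fun x hx => ((hg' x hx).sub (hf' x hx)).differentiableAt.differentiableWithinAt
    · rw [interior_Icc]
      intro x hx
      have := ((hg' x hx).sub (hf' x hx)).deriv
      change 0 ≤ deriv (g - f) x
      rw [this]
      linarith [h x hx]
  have := hmono (left_mem_Icc.2 hab) (right_mem_Icc.2 hab) hab
  simp only at this
  linarith

theorem abs_sub_le_sub_of_abs_hasDerivAt_le {f g f' g' : ℝ → ℝ} {a b : ℝ} (hab : a ≤ b)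
    (hf : ContinuousOn f (Icc a b)) (hg : ContinuousOn g (Icc a b))
    (hf' : ∀ x ∈ Ioo a b, HasDerivAt f (f' x) x) (hg' : ∀ x ∈ Ioo a b, HasDerivAt g (g' x) x)
    (h : ∀ x ∈ Ioo a b, |f' x| ≤ g' x) : |f b - f a| ≤ g b - g a := by
  have h1 := sub_le_sub_of_hasDerivAt_le hab hf hg hf' hg' fun x hx => (abs_le.1 (h x hx)).2
  have h2 := sub_le_sub_of_hasDerivAt_le hab hf.neg hg (fun x hx => (hf' x hx).neg) hg'
    fun x hx => by linarith [(abs_le.1 (h x hx)).1]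
  simp only [Pi.neg_apply] at h2
  exact abs_le.2 ⟨by linarith, h1⟩

/-- A continuous function vanishing at `0` stays below `c` if being at most `c` on an initial
interval forces it to be strictly less than `c` at the end of that interval. -/
theorem le_of_bootstrap {f : ℝ → ℝ} {c S : ℝ} (hf : Continuous f) (h0 : f 0 < c)
    (h : ∀ T ∈ Icc 0 S, (∀ s ∈ Icc 0 T, f s ≤ c) → f T < c) : ∀ s ∈ Icc 0 S, f s ≤ c := by
  by_contra! hcon
  obtain ⟨s₀, hs₀, hfs₀⟩ := hcon
  have hcomp : IsCompact (Icc 0 S ∩ {s | c ≤ f s}) :=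
    isCompact_Icc.inter_right (isClosed_le continuous_const hf)
  obtain ⟨T, ⟨hT, hfT⟩, hmin⟩ := hcomp.exists_isLeast ⟨s₀, hs₀, hfs₀.le⟩
  have hlt : ∀ s ∈ Ico 0 T, f s < c := by
    intro s hs
    by_contra! hc
    exact absurd (hmin ⟨⟨hs.1, hs.2.le.trans hT.2⟩, hc⟩) (not_le.2 hs.2)
  obtain ⟨x, hx, hfx⟩ := intermediate_value_Icc hT.1 hf.continuousOn ⟨h0.le, hfT⟩
  have hxT : x = T := le_antisymm hx.2 (hmin ⟨⟨hx.1, hx.2.trans hT.2⟩, hfx.ge⟩)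
  subst hxT
  refine absurd (h x hT fun s hs => ?_) (not_lt.2 hfx.ge)
  rcases hs.2.lt_or_eq with hlt' | rfl
  · exact (hlt s ⟨hs.1, hlt'⟩).le
  · exact hfx.le

/-- The logarithmic radial variable, with the radius measured in units of `2μ`. -/
def logRadius (s : ℝ) : ℝ := log (1 + s ^ 2)

theorem exp_logRadius (s : ℝ) : exp (logRadius s) = 1 + s ^ 2 := exp_log (by positivity)

theorem exp_neg_logRadius (s : ℝ) : exp (-logRadius s) = (1 + s ^ 2)⁻¹ := by
  rw [exp_neg, exp_logRadius]

theorem logRadius_nonneg (s : ℝ) : 0 ≤ logRadius s :=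
  log_nonneg (by nlinarith [sq_nonneg s])

theorem logRadius_zero : logRadius 0 = 0 := by simp [logRadius]

theorem hasDerivAt_logRadius (s : ℝ) : HasDerivAt logRadius (2 * s / (1 + s ^ 2)) s := by
  have h : HasDerivAt (fun s : ℝ => 1 + s ^ 2) (2 * s) s := by
    simpa using (hasDerivAt_pow 2 s).const_add 1
  exact h.log (by positivity)

theorem continuous_logRadius : Continuous logRadius :=
  continuous_iff_continuousAt.2 fun s => (hasDerivAt_logRadius s).continuousAt

theorem logRadius_le_logRadius {a b : ℝ} (ha : 0 ≤ a) (hab : a ≤ b) :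
    logRadius a ≤ logRadius b :=
  log_le_log (by positivity) (by gcongr)

/-- The equation of the standard bubble in normalized form: `B = γ - w / γ`, `ε = γ⁻²`, the radius
`s` is measured in units of `2μ`, and `m` is half of `s` times the derivative of `w`. -/
structure IsNormalizedBubble (ε : ℝ) (w m : ℝ → ℝ) : Prop where
  continuous_left : Continuous w
  continuous_right : Continuous m
  left_zero : w 0 = 0
  right_zero : m 0 = 0
  hasDerivAt_left : ∀ s, 0 < s → HasDerivAt w (2 * m s / s) s
  hasDerivAt_right : ∀ s, 0 < s →
    HasDerivAt m (2 * s * ((1 - ε * w s) * exp (-2 * w s + ε * w s ^ 2))) s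

/-- The energy `∫ F` with respect to `d(s²)`, where `F = exp (-2w + εw²)`. -/
def bubbleEnergy (ε : ℝ) (w : ℝ → ℝ) (s : ℝ) : ℝ :=
  ∫ x in (0 : ℝ)..s, 2 * x * exp (-2 * w x + ε * w x ^ 2)

/-- The first moment `∫ w F` with respect to `d(s²)`, where `F = exp (-2w + εw²)`. -/
def bubbleMoment (ε : ℝ) (w : ℝ → ℝ) (s : ℝ) : ℝ :=
  ∫ x in (0 : ℝ)..s, 2 * x * (w x * exp (-2 * w x + ε * w x ^ 2))

theorem hasDerivAt_bubbleEnergy {w : ℝ → ℝ} (ε : ℝ) (hw : Continuous w) (s : ℝ) :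
    HasDerivAt (bubbleEnergy ε w) (2 * s * exp (-2 * w s + ε * w s ^ 2)) s := by
  have hc : Continuous fun x => 2 * x * exp (-2 * w x + ε * w x ^ 2) := by fun_prop
  exact hc.integral_hasStrictDerivAt 0 s |>.hasDerivAt

theorem hasDerivAt_bubbleMoment {w : ℝ → ℝ} (ε : ℝ) (hw : Continuous w) (s : ℝ) :
    HasDerivAt (bubbleMoment ε w) (2 * s * (w s * exp (-2 * w s + ε * w s ^ 2))) s := by
  have hc : Continuous fun x => 2 * x * (w x * exp (-2 * w x + ε * w x ^ 2)) := by fun_prop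
  exact hc.integral_hasStrictDerivAt 0 s |>.hasDerivAt

theorem continuous_bubbleEnergy {w : ℝ → ℝ} (ε : ℝ) (hw : Continuous w) :
    Continuous (bubbleEnergy ε w) :=
  continuous_iff_continuousAt.2 fun s => (hasDerivAt_bubbleEnergy ε hw s).continuousAt

theorem continuous_bubbleMoment {w : ℝ → ℝ} (ε : ℝ) (hw : Continuous w) :
    Continuous (bubbleMoment ε w) :=
  continuous_iff_continuousAt.2 fun s => (hasDerivAt_bubbleMoment ε hw s).continuousAt

theorem bubbleEnergy_zero (ε : ℝ) (w : ℝ → ℝ) : bubbleEnergy ε w 0 = 0 := by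
  simp [bubbleEnergy]

theorem bubbleMoment_zero (ε : ℝ) (w : ℝ → ℝ) : bubbleMoment ε w 0 = 0 := by
  simp [bubbleMoment]

theorem bubbleEnergy_pos {w : ℝ → ℝ} (ε : ℝ) (hw : Continuous w) {s : ℝ} (hs : 0 < s) :
    0 < bubbleEnergy ε w s := by
  apply intervalIntegral.intervalIntegral_pos_of_pos_on _ _ hs
  · exact Continuous.intervalIntegrable (by fun_prop) _ _
  · intro x hx
    have := hx.1
    positivity

namespace IsNormalizedBubble

variable {ε : ℝ} {w m : ℝ → ℝ}

theorem eq_energy_sub_moment (h : IsNormalizedBubble ε w m) {s : ℝ} (hs : 0 ≤ s) :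
    m s = bubbleEnergy ε w s - ε * bubbleMoment ε w s := by
  have hw := h.continuous_left
  have key := abs_sub_le_sub_of_abs_hasDerivAt_le (g := fun _ => 0) (g' := fun _ => 0)
    (f := fun x => m x - (bubbleEnergy ε w x - ε * bubbleMoment ε w x)) hs
    (h.continuous_right.sub ((continuous_bubbleEnergy ε hw).sub
      ((continuous_bubbleMoment ε hw).const_mul ε))).continuousOn continuousOn_const
    (fun x hx => (h.hasDerivAt_right x hx.1).sub ((hasDerivAt_bubbleEnergy ε hw x).sub
      ((hasDerivAt_bubbleMoment ε hw x).const_mul ε))) (fun x _ => hasDerivAt_const x 0)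
    (fun x _ => by rw [abs_nonpos_iff]; ring)
  simp only [bubbleEnergy_zero, bubbleMoment_zero, h.right_zero, sub_self, mul_zero, sub_zero,
    abs_nonpos_iff] at key
  linarith

/-- The Pohozaev identity. -/
theorem sq_eq_energy_sub (h : IsNormalizedBubble ε w m) {s : ℝ} (hs : 0 ≤ s) :
    m s ^ 2 = bubbleEnergy ε w s - s ^ 2 * exp (-2 * w s + ε * w s ^ 2) := by
  have hw := h.continuous_left
  have hm := h.continuous_right
  have hF : ∀ x, 0 < x → HasDerivAt (fun x => exp (-2 * w x + ε * w x ^ 2))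
      (exp (-2 * w x + ε * w x ^ 2) *
        (-2 * (2 * m x / x) + ε * (2 * w x * (2 * m x / x)))) x := by
    intro x hx
    have hwx := h.hasDerivAt_left x hx
    have := ((hwx.const_mul (-2)).add ((hwx.pow 2).const_mul ε)).exp
    refine this.congr_deriv ?_
    simp
  have key := abs_sub_le_sub_of_abs_hasDerivAt_le (g := fun _ => 0) (g' := fun _ => 0)
    (f := fun x => m x ^ 2 - (bubbleEnergy ε w x - x ^ 2 * exp (-2 * w x + ε * w x ^ 2))) hs
    (by have := continuous_bubbleEnergy ε hw
        exact Continuous.continuousOn (by fun_prop)) continuousOn_const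
    (fun x hx => ((h.hasDerivAt_right x hx.1).pow 2).sub ((hasDerivAt_bubbleEnergy ε hw x).sub
      ((hasDerivAt_pow 2 x).mul (hF x hx.1)))) (fun x _ => hasDerivAt_const x 0)
    (fun x hx => by
      have := hx.1.ne'
      rw [abs_nonpos_iff]
      norm_num
      field_simp
      ring)
  simp only [bubbleEnergy_zero, h.right_zero, sub_self, sub_zero,
    abs_nonpos_iff, zero_mul, ne_eq, OfNat.ofNat_ne_zero, not_false_eq_true, zero_pow] at key
  linarith

theorem tendsto_sq_div_energy (h : IsNormalizedBubble ε w m) :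
    Tendsto (fun s => s ^ 2 / bubbleEnergy ε w s) (𝓝[>] 0) (𝓝 1) := by
  have hw := h.continuous_left
  refine HasDerivAt.lhopital_zero_nhdsGT (f' := fun s => 2 * s)
    (g' := fun s => 2 * s * exp (-2 * w s + ε * w s ^ 2)) ?_ ?_ ?_ ?_ ?_ ?_
  · exact Eventually.of_forall fun s => by simpa using hasDerivAt_pow 2 s
  · exact Eventually.of_forall fun s => hasDerivAt_bubbleEnergy ε hw s
  · filter_upwards [self_mem_nhdsWithin] with s hs
    have : (0 : ℝ) < s := hs
    positivity
  · exact (Continuous.tendsto' (by fun_prop) 0 0 (by simp)).mono_left nhdsWithin_le_nhds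
  · exact ((continuous_bubbleEnergy ε hw).tendsto' 0 0 (bubbleEnergy_zero ε w)).mono_left
      nhdsWithin_le_nhds
  · have hc : Tendsto (fun s => (exp (-2 * w s + ε * w s ^ 2))⁻¹) (𝓝[>] 0) (𝓝 1) := by
      refine (Continuous.tendsto' ?_ 0 1 (by simp [h.left_zero])).mono_left nhdsWithin_le_nhds
      exact Continuous.inv₀ (by fun_prop) fun s => (exp_pos _).ne'
    refine hc.congr' ?_
    filter_upwards [self_mem_nhdsWithin] with s hs
    have : (0 : ℝ) < s := hs
    field_simp

theorem exponent_le {γ x t : ℝ} (hε : ε * γ ^ 2 = 1) (hγ : 2 ≤ γ) (ht : 0 ≤ t) (htγ : t ≤ γ)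
    (hx : |x - t| ≤ 2) : -2 * x + ε * x ^ 2 ≤ 8 - 2 * t := by
  obtain ⟨h1, h2⟩ := abs_le.1 hx
  have hε0 : 0 < ε := by
    by_contra! hneg
    nlinarith [sq_nonneg γ]
  have hx2 : x ^ 2 ≤ (2 * γ) ^ 2 := sq_le_sq' (by linarith) (by linarith)
  nlinarith

theorem exp_sub_two_mul_logRadius (c s : ℝ) :
    exp (c - 2 * logRadius s) = exp c / (1 + s ^ 2) ^ 2 := by
  rw [exp_sub, two_mul, exp_add, exp_logRadius, sq (1 + s ^ 2)]

theorem weight_le {γ S : ℝ} (hε : ε * γ ^ 2 = 1) (hγ : 2 ≤ γ) (hS : logRadius S ≤ γ)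
    (hd : ∀ s ∈ Icc 0 S, |w s - logRadius s| ≤ 2) {s : ℝ} (hs : s ∈ Icc 0 S) :
    exp (-2 * w s + ε * w s ^ 2) ≤ exp 8 / (1 + s ^ 2) ^ 2 := by
  rw [← exp_sub_two_mul_logRadius]
  exact exp_le_exp.2 (exponent_le hε hγ (logRadius_nonneg s)
    ((logRadius_le_logRadius hs.1 hs.2).trans hS) (hd s hs))

theorem le_weight {S : ℝ} (hε : 0 ≤ ε) (hd : ∀ s ∈ Icc 0 S, |w s - logRadius s| ≤ 2)
    {s : ℝ} (hs : s ∈ Icc 0 S) :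
    exp (-4) / (1 + s ^ 2) ^ 2 ≤ exp (-2 * w s + ε * w s ^ 2) := by
  rw [← exp_sub_two_mul_logRadius]
  have := (abs_le.1 (hd s hs)).2
  exact exp_le_exp.2 (by nlinarith [mul_nonneg hε (sq_nonneg (w s))])

theorem hasDerivAt_neg_inv_one_add_sq (s : ℝ) :
    HasDerivAt (fun s : ℝ => -(1 + s ^ 2)⁻¹) (2 * s / (1 + s ^ 2) ^ 2) s := by
  have h : HasDerivAt (fun s : ℝ => 1 + s ^ 2) (2 * s) s := by
    simpa using (hasDerivAt_pow 2 s).const_add 1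
  refine (h.inv (by positivity)).neg.congr_deriv ?_
  ring

theorem abs_moment_le (hw : Continuous w) {γ S : ℝ} (hε : ε * γ ^ 2 = 1) (hγ : 2 ≤ γ)
    (hS0 : 0 ≤ S) (hS : logRadius S ≤ γ) (hd : ∀ s ∈ Icc 0 S, |w s - logRadius s| ≤ 2) :
    |bubbleMoment ε w S| ≤ 3 * exp 12 * bubbleEnergy ε w S := by
  have hε0 : 0 < ε := by
    by_contra! hneg
    nlinarith [sq_nonneg γ]
  have hI : |bubbleMoment ε w S - bubbleMoment ε w 0| ≤
      exp 8 * ((logRadius S + 3) * -(1 + S ^ 2)⁻¹)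
        - exp 8 * ((logRadius 0 + 3) * -(1 + (0 : ℝ) ^ 2)⁻¹) := by
    refine abs_sub_le_sub_of_abs_hasDerivAt_le (f := bubbleMoment ε w)
      (g := fun s => exp 8 * ((logRadius s + 3) * -(1 + s ^ 2)⁻¹)) hS0
      (continuous_bubbleMoment ε hw).continuousOn ?_
      (fun x _ => hasDerivAt_bubbleMoment ε hw x)
      (fun x _ => (((hasDerivAt_logRadius x).add_const 3).mul
        (hasDerivAt_neg_inv_one_add_sq x)).const_mul (exp 8)) ?_
    · have := continuous_logRadius
      have : Continuous fun s : ℝ => (1 + s ^ 2)⁻¹ :=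
        Continuous.inv₀ (by fun_prop) fun s => by positivity
      exact Continuous.continuousOn (by fun_prop)
    · intro x hx
      have hx' := Ioo_subset_Icc_self hx
      have hwx := weight_le hε hγ hS hd hx'
      have hx0 := hx.1
      have hwa : |w x| ≤ logRadius x + 2 := by
        have := abs_le.1 (hd x hx')
        have := logRadius_nonneg x
        exact abs_le.2 ⟨by linarith, by linarith⟩
      rw [abs_mul, abs_mul (w x), abs_exp, abs_of_pos (by positivity : 0 < 2 * x)]
      calc 2 * x * (|w x| * exp (-2 * w x + ε * w x ^ 2))
          ≤ 2 * x * ((logRadius x + 2) * (exp 8 / (1 + x ^ 2) ^ 2)) := by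
            have := logRadius_nonneg x
            gcongr
        _ = _ := by
            field_simp
            ring
  have hJ : exp (-4) * -(1 + S ^ 2)⁻¹ - exp (-4) * -(1 + (0 : ℝ) ^ 2)⁻¹ ≤
      bubbleEnergy ε w S - bubbleEnergy ε w 0 := by
    refine sub_le_sub_of_hasDerivAt_le (g := bubbleEnergy ε w)
      (f := fun s => exp (-4) * -(1 + s ^ 2)⁻¹) hS0 ?_
      (continuous_bubbleEnergy ε hw).continuousOn
      (fun x _ => (hasDerivAt_neg_inv_one_add_sq x).const_mul _)
      (fun x _ => hasDerivAt_bubbleEnergy ε hw x) ?_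
    · have : Continuous fun s : ℝ => (1 + s ^ 2)⁻¹ :=
        Continuous.inv₀ (by fun_prop) fun s => by positivity
      exact Continuous.continuousOn (by fun_prop)
    · intro x hx
      have hwx := le_weight hε0.le hd (Ioo_subset_Icc_self hx)
      have hx0 := hx.1
      calc exp (-4) * (2 * x / (1 + x ^ 2) ^ 2) = 2 * x * (exp (-4) / (1 + x ^ 2) ^ 2) := by ring
        _ ≤ _ := by gcongr
  rw [bubbleMoment_zero, logRadius_zero, sub_zero] at hI
  rw [bubbleEnergy_zero, sub_zero] at hJ
  norm_num at hI hJ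
  have h12 : exp 12 * exp (-4) = exp 8 := by rw [← exp_add]; norm_num
  have hpos : 0 ≤ exp 8 * (logRadius S * (1 + S ^ 2)⁻¹) := by
    have := logRadius_nonneg S
    positivity
  have h12' : 0 ≤ 3 * exp 12 := by positivity
  have hmul := mul_le_mul_of_nonneg_left hJ h12'
  have : 3 * exp 12 * (-(exp (-4) * (1 + S ^ 2)⁻¹) + exp (-4)) =
      3 * exp 8 - 3 * (exp 8 * (1 + S ^ 2)⁻¹) := by rw [← h12]; ring
  linarith

/-- The ratio `s² / J` is controlled by `1 + s²`. -/
theorem abs_sq_div_energy_sub_le (h : IsNormalizedBubble ε w m) {A S : ℝ} (hε : 0 ≤ ε)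
    (hA : 0 ≤ A) (hεA : 10 * (ε * A) ≤ 1) (hS : 0 < S)
    (hI : ∀ s ∈ Icc 0 S, |bubbleMoment ε w s| ≤ A * bubbleEnergy ε w s) :
    |S ^ 2 / bubbleEnergy ε w S - (1 + S ^ 2)| ≤ 3 * (ε * A) * S ^ 2 := by
  have hw := h.continuous_left
  have hJpos : ∀ s, 0 < s → 0 < bubbleEnergy ε w s := fun s hs => bubbleEnergy_pos ε hw hs
  set D : ℝ → ℝ := Function.update (fun s => s ^ 2 / bubbleEnergy ε w s) 0 1 with hD
  have hDeq : ∀ s, 0 < s → D s = s ^ 2 / bubbleEnergy ε w s := fun s hs => by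
    simp [hD, hs.ne']
  have hder : ∀ s, 0 < s → HasDerivAt D
      (2 * s * (m s / bubbleEnergy ε w s) ^ 2) s := by
    intro s hs
    have hJ := (hJpos s hs).ne'
    have h1 := (hasDerivAt_pow 2 s).div (hasDerivAt_bubbleEnergy ε hw s) hJ
    have h2 : HasDerivAt (fun s => s ^ 2 / bubbleEnergy ε w s)
        (2 * s * (m s / bubbleEnergy ε w s) ^ 2) s := by
      refine h1.congr_deriv ?_
      rw [div_pow, h.sq_eq_energy_sub hs.le]
      norm_num
      field_simp
    refine h2.congr_of_eventuallyEq ?_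
    filter_upwards [lt_mem_nhds hs] with x hx using hDeq x hx
  have hcont : ContinuousOn D (Icc 0 S) := by
    intro s hs
    rcases hs.1.eq_or_lt with rfl | hs0
    · have : ContinuousWithinAt D (Ici 0) 0 := by
        rw [← continuousWithinAt_Ioi_iff_Ici]
        have hlim := h.tendsto_sq_div_energy
        have hD0 : D 0 = 1 := by simp [hD]
        rw [ContinuousWithinAt, hD0]
        refine hlim.congr' ?_
        filter_upwards [self_mem_nhdsWithin] with x hx using (hDeq x hx).symm
      exact this.mono Icc_subset_Ici_self
    · exact (hder s hs0).continuousAt.continuousWithinAt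
  have key := abs_sub_le_sub_of_abs_hasDerivAt_le (f := fun s => D s - s ^ 2)
    (g := fun s => 3 * (ε * A) * s ^ 2) hS.le
    (hcont.sub (by fun_prop)) (by fun_prop)
    (fun x hx => (hder x hx.1).sub (hasDerivAt_pow 2 x))
    (fun x _ => (hasDerivAt_pow 2 x).const_mul _) (by
      intro x hx
      have hx0 := hx.1
      have hJ := hJpos x hx0
      have hIx := abs_le.1 (hI x (Ioo_subset_Icc_self hx))
      set a := bubbleMoment ε w x / bubbleEnergy ε w x with ha
      have ha1 : a ≤ A := by rw [ha, div_le_iff₀ hJ]; exact hIx.2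
      have ha2 : -A ≤ a := by rw [ha, le_div_iff₀ hJ]; linarith [hIx.1]
      have hm : m x / bubbleEnergy ε w x = 1 - ε * a := by
        rw [h.eq_energy_sub_moment hx0.le, ha]
        field_simp
      have h1 : ε * a ≤ ε * A := by gcongr
      have h2 : -(ε * A) ≤ ε * a := by nlinarith
      have h3 : |(1 - ε * a) ^ 2 - 1| ≤ 3 * (ε * A) := by
        have h0 : 0 ≤ ε * A := by positivity
        rw [abs_le]
        constructor <;> nlinarith
      rw [hm]
      have : 2 * x * (1 - ε * a) ^ 2 - (2 : ℕ) * x ^ (2 - 1) = 2 * x * ((1 - ε * a) ^ 2 - 1) := by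
        norm_num
        ring
      rw [this, abs_mul, abs_of_pos (by positivity : 0 < 2 * x)]
      calc 2 * x * |(1 - ε * a) ^ 2 - 1| ≤ 2 * x * (3 * (ε * A)) := by gcongr
        _ = _ := by norm_num; ring)
  have hD0 : D 0 = 1 := by simp [hD]
  simp only [hDeq S hS, hD0] at key
  norm_num at key
  convert key using 2
  ring

/-- Comparison of the mass of a bubble with its leading order profile. -/
theorem abs_mass_sub_le (h : IsNormalizedBubble ε w m) {A S : ℝ} (hε : 0 ≤ ε)
    (hA : 0 ≤ A) (hεA : 10 * (ε * A) ≤ 1) (hS : 0 < S)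
    (hI : ∀ s ∈ Icc 0 S, |bubbleMoment ε w s| ≤ A * bubbleEnergy ε w s) :
    |m S - S ^ 2 / (1 + S ^ 2)| ≤ 6 * (ε * A) * (S ^ 2 / (1 + S ^ 2)) := by
  have hJ := bubbleEnergy_pos ε h.continuous_left hS
  have hD := abs_le.1 (h.abs_sq_div_energy_sub_le hε hA hεA hS hI)
  have hIx := abs_le.1 (hI S ⟨hS.le, le_rfl⟩)
  set J := bubbleEnergy ε w S with hJdef
  have h0 : 0 ≤ ε * A := by positivity
  have hS2 : 0 < S ^ 2 := by positivity
  have e1 : S ^ 2 ≤ (1 + 3 * (ε * A)) * (1 + S ^ 2) * J := by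
    rw [← div_le_iff₀ hJ]
    nlinarith [hD.2]
  have e2 : (1 - 3 * (ε * A)) * (1 + S ^ 2) * J ≤ S ^ 2 := by
    rw [← le_div_iff₀ hJ]
    nlinarith [hD.1]
  have hm := h.eq_energy_sub_moment hS.le
  rw [← hJdef] at hm
  have f1 : m S ≤ (1 + ε * A) * J := by
    rw [hm]
    nlinarith [mul_le_mul_of_nonneg_left hIx.1 hε]
  have f2 : (1 - ε * A) * J ≤ m S := by
    rw [hm]
    nlinarith [mul_le_mul_of_nonneg_left hIx.2 hε]
  set x := ε * A with hx
  set P := (1 + S ^ 2) * J with hP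
  have hPpos : 0 < P := by positivity
  have hm1 : m S * (1 + S ^ 2) ≤ (1 + x) * P := by
    have := mul_le_mul_of_nonneg_right f1 (by positivity : 0 ≤ 1 + S ^ 2)
    rw [hP]; linarith
  have hm2 : (1 - x) * P ≤ m S * (1 + S ^ 2) := by
    have := mul_le_mul_of_nonneg_right f2 (by positivity : 0 ≤ 1 + S ^ 2)
    rw [hP]; linarith
  have g1 : (1 + x) * P ≤ (1 + 6 * x) * S ^ 2 := by
    have : (1 + x) * P ≤ (1 + 6 * x) * ((1 - 3 * x) * P) := by nlinarith [mul_nonneg h0 hPpos.le]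
    have e2' : (1 - 3 * x) * P ≤ S ^ 2 := by rw [hP]; linarith
    nlinarith
  have g2 : (1 - 6 * x) * S ^ 2 ≤ (1 - x) * P := by
    have : (1 - 6 * x) * ((1 + 3 * x) * P) ≤ (1 - x) * P := by nlinarith [mul_nonneg h0 hPpos.le]
    have e1' : S ^ 2 ≤ (1 + 3 * x) * P := by rw [hP]; linarith
    nlinarith
  have hq : m S - S ^ 2 / (1 + S ^ 2) = (m S * (1 + S ^ 2) - S ^ 2) / (1 + S ^ 2) := by
    field_simp
  rw [hq, ← mul_div_assoc, abs_div, abs_of_pos (by positivity : 0 < 1 + S ^ 2)]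
  gcongr
  exact abs_le.2 ⟨by linarith, by linarith⟩

theorem abs_sub_logRadius_le (h : IsNormalizedBubble ε w m) {A S : ℝ} (hε : 0 ≤ ε)
    (hA : 0 ≤ A) (hεA : 10 * (ε * A) ≤ 1) (hS : 0 ≤ S)
    (hI : ∀ s ∈ Icc 0 S, |bubbleMoment ε w s| ≤ A * bubbleEnergy ε w s) :
    |w S - logRadius S| ≤ 6 * (ε * A) * logRadius S := by
  have hw := h.continuous_left
  have hl := continuous_logRadius
  have key := abs_sub_le_sub_of_abs_hasDerivAt_le (f := fun s => w s - logRadius s)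
    (g := fun s => 6 * (ε * A) * logRadius s) hS (by fun_prop) (by fun_prop)
    (fun x hx => (h.hasDerivAt_left x hx.1).sub (hasDerivAt_logRadius x))
    (fun x _ => (hasDerivAt_logRadius x).const_mul _) (by
      intro x hx
      have hx0 := hx.1
      have hm := h.abs_mass_sub_le hε hA hεA hx0 fun s hs => hI s ⟨hs.1, hs.2.trans hx.2.le⟩
      have : 2 * m x / x - 2 * x / (1 + x ^ 2) = 2 / x * (m x - x ^ 2 / (1 + x ^ 2)) := by
        field_simp
      rw [this, abs_mul, abs_of_pos (by positivity : 0 < 2 / x)]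
      calc 2 / x * |m x - x ^ 2 / (1 + x ^ 2)|
          ≤ 2 / x * (6 * (ε * A) * (x ^ 2 / (1 + x ^ 2))) := by gcongr
        _ = _ := by field_simp)
  simpa [h.left_zero, logRadius_zero] using key

theorem abs_exp_sub_one_le_mul_exp {y c : ℝ} (hy : y ≤ c) (hc : 0 ≤ c) :
    |exp y - 1| ≤ |y| * exp c := by
  have h1 : 1 ≤ exp c := one_le_exp hc
  have h2 : exp y ≤ exp c := exp_le_exp.2 hy
  have hy0 := abs_nonneg y
  refine abs_le.2 ⟨?_, ?_⟩
  · nlinarith [add_one_le_exp y, neg_abs_le y]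
  · have h3 := add_one_le_exp (-y)
    have h4 : exp y * exp (-y) = 1 := by rw [← exp_add]; simp
    nlinarith [le_abs_self y, exp_pos y]

theorem abs_moment_integrand_sub_le {γ x t A : ℝ} (hε : ε * γ ^ 2 = 1) (hγ : 2 ≤ γ) (ht : 0 ≤ t)
    (htγ : t ≤ γ) (hA : 1 ≤ A) (hεA : 10 * (ε * A) ≤ 1) (hε0 : 0 < ε) (hx : |x - t| ≤ 2)
    (hxt : |x - t| ≤ 6 * (ε * A) * t) :
    |x * exp (-2 * x + ε * x ^ 2) - t * exp (-2 * t)| ≤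
      exp (-2 * t) * (ε * (12 * A * exp 8) * (t + t ^ 2 + t ^ 3)) := by
  have he := exponent_le hε hγ ht htγ hx
  set y := -2 * (x - t) + ε * x ^ 2 with hy
  have hy8 : y ≤ 8 := by rw [hy]; linarith
  have hsplit : exp (-2 * x + ε * x ^ 2) = exp (-2 * t) * exp y := by
    rw [← exp_add, hy]
    ring_nf
  have hxt' : |x - t| ≤ t := hxt.trans (by nlinarith)
  have hx2 : x ^ 2 ≤ (2 * t) ^ 2 := by
    have := abs_le.1 hxt'
    exact sq_le_sq' (by linarith) (by linarith)
  have hyabs : |y| ≤ 12 * (ε * A) * t + 4 * ε * t ^ 2 := by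
    calc |y| ≤ |-2 * (x - t)| + |ε * x ^ 2| := abs_add_le _ _
      _ = 2 * |x - t| + ε * x ^ 2 := by
        rw [abs_mul, abs_of_nonneg (by positivity : 0 ≤ ε * x ^ 2)]
        norm_num
      _ ≤ _ := by nlinarith
  have h1 := abs_exp_sub_one_le_mul_exp hy8 (by norm_num)
  have h8 : exp y ≤ exp 8 := exp_le_exp.2 hy8
  have hrw : x * exp (-2 * x + ε * x ^ 2) - t * exp (-2 * t) =
      exp (-2 * t) * ((x - t) * exp y + t * (exp y - 1)) := by
    rw [hsplit]
    ring
  rw [hrw, abs_mul, abs_exp]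
  gcongr
  calc |(x - t) * exp y + t * (exp y - 1)|
      ≤ |(x - t) * exp y| + |t * (exp y - 1)| := abs_add_le _ _
    _ = |x - t| * exp y + t * |exp y - 1| := by rw [abs_mul, abs_mul, abs_exp, abs_of_nonneg ht]
    _ ≤ (6 * (ε * A) * t) * exp 8 + t * ((12 * (ε * A) * t + 4 * ε * t ^ 2) * exp 8) := by
      gcongr
      exact h1.trans (by gcongr)
    _ = ε * exp 8 * (6 * A * t + 12 * A * t ^ 2 + 4 * t ^ 3) := by ring
    _ ≤ ε * exp 8 * (12 * A * t + 12 * A * t ^ 2 + 12 * A * t ^ 3) := by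
      gcongr <;> linarith
    _ = _ := by ring

theorem abs_moment_sub_le (hw : Continuous w) {γ S A : ℝ} (hε : ε * γ ^ 2 = 1) (hγ : 2 ≤ γ)
    (hA : 1 ≤ A) (hεA : 10 * (ε * A) ≤ 1) (hε0 : 0 < ε) (hS0 : 0 ≤ S) (hS : logRadius S ≤ γ)
    (hd : ∀ s ∈ Icc 0 S, |w s - logRadius s| ≤ 2)
    (hd' : ∀ s ∈ Icc 0 S, |w s - logRadius s| ≤ 6 * (ε * A) * logRadius s) :
    |bubbleMoment ε w S - (1 - (logRadius S + 1) * (1 + S ^ 2)⁻¹)| ≤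
      9 * (ε * (12 * A * exp 8)) := by
  set K := ε * (12 * A * exp 8) with hK
  have hK0 : 0 ≤ K := by positivity
  have hl := continuous_logRadius
  have hJ := continuous_bubbleMoment ε hw
  have hinv : Continuous fun s : ℝ => (1 + s ^ 2)⁻¹ :=
    Continuous.inv₀ (by fun_prop) fun s => by positivity
  have hP : ∀ x, HasDerivAt
      (fun s => logRadius s ^ 3 + 4 * logRadius s ^ 2 + 9 * logRadius s + 9)
      ((3 * logRadius x ^ 2 + 8 * logRadius x + 9) * (2 * x / (1 + x ^ 2))) x := by
    intro x
    have ht := hasDerivAt_logRadius x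
    refine ((((ht.pow 3).add ((ht.pow 2).const_mul 4)).add (ht.const_mul 9)).add_const
      9).congr_deriv ?_
    norm_num
    ring
  have key := abs_sub_le_sub_of_abs_hasDerivAt_le
    (f := fun s => bubbleMoment ε w s - (logRadius s + 1) * -(1 + s ^ 2)⁻¹)
    (g := fun s => K * ((logRadius s ^ 3 + 4 * logRadius s ^ 2 + 9 * logRadius s + 9) *
      -(1 + s ^ 2)⁻¹)) hS0 (by fun_prop) (by fun_prop)
    (fun x _ => (hasDerivAt_bubbleMoment ε hw x).sub (((hasDerivAt_logRadius x).add_const 1).mul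
        (hasDerivAt_neg_inv_one_add_sq x)))
    (fun x _ => ((hP x).mul (hasDerivAt_neg_inv_one_add_sq x)).const_mul K) (by
      intro x hx
      have hx' := Ioo_subset_Icc_self hx
      have hx0 := hx.1
      have hb := abs_moment_integrand_sub_le hε hγ (logRadius_nonneg x)
        ((logRadius_le_logRadius hx0.le hx.2.le).trans hS) hA hεA hε0 (hd x hx') (hd' x hx')
      have he : exp (-2 * logRadius x) = 1 / (1 + x ^ 2) ^ 2 := by
        have := exp_sub_two_mul_logRadius 0 x
        simpa using this
      rw [he, ← hK] at hb
      calc _ = |2 * x * (w x * exp (-2 * w x + ε * w x ^ 2)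
            - logRadius x * (1 / (1 + x ^ 2) ^ 2))| := by
            congr 1
            field_simp
            ring
        _ = 2 * x * |w x * exp (-2 * w x + ε * w x ^ 2)
            - logRadius x * (1 / (1 + x ^ 2) ^ 2)| := by
            rw [abs_mul, abs_of_pos (by positivity : 0 < 2 * x)]
        _ ≤ 2 * x * (1 / (1 + x ^ 2) ^ 2 *
            (K * (logRadius x + logRadius x ^ 2 + logRadius x ^ 3))) := by gcongr
        _ = _ := by
            field_simp
            ring)
  simp only [bubbleMoment_zero, logRadius_zero] at key
  norm_num at key
  have hpos : 0 ≤ K * ((logRadius S ^ 3 + 4 * logRadius S ^ 2 + 9 * logRadius S + 9) *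
      (1 + S ^ 2)⁻¹) := by
    have := logRadius_nonneg S
    positivity
  calc _ = |bubbleMoment ε w S + (logRadius S + 1) * (1 + S ^ 2)⁻¹ - 1| := by ring_nf
    _ ≤ _ := by linarith

set_option maxHeartbeats 1000000 in
/-- The mass after the concentration region is `1 + ε` up to an error `O(ε / γ)`. -/
theorem abs_mass_sub_one_sub_le (h : IsNormalizedBubble ε w m) {γ S A : ℝ} (hε : ε * γ ^ 2 = 1)
    (hγ : 2 ≤ γ) (hA : 1 ≤ A) (hεA : 10 * (ε * A) ≤ 1) (hε0 : 0 < ε) (hS0 : 0 < S)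
    (hS : logRadius S = γ) (hd : ∀ s ∈ Icc 0 S, |w s - logRadius s| ≤ 2)
    (hI : ∀ s ∈ Icc 0 S, |bubbleMoment ε w s| ≤ A * bubbleEnergy ε w s) :
    |m S - 1 - ε| ≤ (114 * A * exp 8 + 4 + (6 * A + 2) ^ 2) * (ε / γ) := by
  have hw := h.continuous_left
  have hA0 : 0 ≤ A := by linarith
  have hd' : ∀ s ∈ Icc 0 S, |w s - logRadius s| ≤ 6 * (ε * A) * logRadius s := fun s hs =>
    h.abs_sub_logRadius_le hε0.le hA0 hεA hs.1 fun x hx => hI x ⟨hx.1, hx.2.trans hs.2⟩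
  have hmom := abs_moment_sub_le hw hε hγ hA hεA hε0 hS0.le hS.le hd hd'
  have hmass := h.abs_mass_sub_le hε0.le hA0 hεA hS0 hI
  have hwt := weight_le hε hγ hS.le hd (right_mem_Icc.2 hS0.le)
  have hm1 := h.eq_energy_sub_moment hS0.le
  have hm2 := h.sq_eq_energy_sub hS0.le
  have hγ0 : 0 < γ := by linarith
  have hεγ : ε = 1 / γ ^ 2 := by field_simp; exact hε
  have hinv : (1 + S ^ 2)⁻¹ = exp (-γ) := by rw [← hS, exp_neg_logRadius]
  rw [hinv, hS] at hmom
  set E := exp (-γ) with hE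
  have hE1 : E * exp γ = 1 := by rw [hE, ← exp_add]; simp
  have hE0 : 0 < E := exp_pos _
  have hE2 : E * γ ^ 2 ≤ 2 := by
    have := pow_div_factorial_le_exp γ hγ0.le 2
    norm_num [Nat.factorial] at this
    nlinarith
  have hE3 : E * γ ^ 3 ≤ 6 := by
    have := pow_div_factorial_le_exp γ hγ0.le 3
    norm_num [Nat.factorial] at this
    nlinarith
  have hρ : S ^ 2 * exp (-2 * w S + ε * w S ^ 2) ≤ 6 * exp 8 * (ε / γ) := by
    calc _ ≤ (1 + S ^ 2) * (exp 8 / (1 + S ^ 2) ^ 2) := by gcongr; linarith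
      _ = exp 8 * E := by rw [← hinv]; field_simp
      _ ≤ exp 8 * (6 / γ ^ 3) := by gcongr; rwa [le_div_iff₀ (by positivity)]
      _ = _ := by rw [hεγ]; field_simp
  have hρ0 : 0 ≤ S ^ 2 * exp (-2 * w S + ε * w S ^ 2) := by positivity
  have hEε : E ≤ 2 * ε := by
    rw [hεγ, mul_one_div, le_div_iff₀ (by positivity)]
    exact hE2
  have hεle : ε ≤ 1 / γ := by
    rw [hεγ]
    exact one_div_le_one_div_of_le hγ0 (by nlinarith)
  have hI1 : |bubbleMoment ε w S - 1| ≤ (108 * A * exp 8 + 4) * (1 / γ) := by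
    have h1 : (γ + 1) * E ≤ 4 * (1 / γ) := by
      rw [mul_one_div, le_div_iff₀ hγ0]
      nlinarith
    have h2 : 9 * (ε * (12 * A * exp 8)) ≤ 108 * A * exp 8 * (1 / γ) := by
      calc _ = 108 * A * exp 8 * ε := by ring
        _ ≤ _ := by gcongr
    have h3 : 0 ≤ (γ + 1) * E := by positivity
    have h4 := abs_le.1 hmom
    exact abs_le.2 ⟨by linarith, by linarith⟩
  have hm3 : |m S - 1| ≤ (6 * A + 2) * ε := by
    have hq : S ^ 2 / (1 + S ^ 2) = 1 - E := by rw [← hinv]; field_simp; ring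
    rw [hq] at hmass
    have h4 := abs_le.1 hmass
    have h5 : 6 * (ε * A) * (1 - E) ≤ 6 * (ε * A) := by
      have : 0 ≤ 6 * (ε * A) := by positivity
      nlinarith
    exact abs_le.2 ⟨by linarith, by linarith⟩
  have hm4 : (m S - 1) ^ 2 ≤ (6 * A + 2) ^ 2 * (ε / γ) := by
    calc (m S - 1) ^ 2 = |m S - 1| ^ 2 := (sq_abs _).symm
      _ ≤ ((6 * A + 2) * ε) ^ 2 := by gcongr
      _ = (6 * A + 2) ^ 2 * (ε * ε) := by ring
      _ ≤ (6 * A + 2) ^ 2 * (ε * (1 / γ)) := by gcongr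
      _ = _ := by ring
  have hid : m S - 1 - ε = ε * (bubbleMoment ε w S - 1)
      - S ^ 2 * exp (-2 * w S + ε * w S ^ 2) - (m S - 1) ^ 2 := by
    linear_combination hm2 - hm1
  have hεI : |ε * (bubbleMoment ε w S - 1)| ≤ (108 * A * exp 8 + 4) * (ε / γ) := by
    rw [abs_mul, abs_of_pos hε0]
    calc _ ≤ ε * ((108 * A * exp 8 + 4) * (1 / γ)) := by gcongr
      _ = _ := by ring
  have h6 := abs_le.1 hεI
  have h7 : exp 8 * (ε / γ) ≤ A * exp 8 * (ε / γ) := by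
    have : 0 ≤ exp 8 * (ε / γ) := by positivity
    nlinarith
  have h8 : 0 ≤ (6 * A + 2) ^ 2 * (ε / γ) := by positivity
  have h9 : 0 ≤ A * exp 8 * (ε / γ) := by positivity
  rw [hid]
  have h10 := sq_nonneg (m S - 1)
  exact abs_le.2 ⟨by linarith, by linarith⟩

theorem abs_density_le {γ x t : ℝ} (hε : ε * γ ^ 2 = 1) (hε0 : 0 < ε) (hε1 : ε ≤ 1)
    (ht : 0 ≤ t) (htγ : t ≤ γ ^ 2) (hx : |x - t| ≤ 2) :
    |(1 - ε * x) * exp (-2 * x + ε * x ^ 2)| ≤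
      exp (-t) * (4 * exp 8 * (exp (-t / 2) + ε * exp ((t - γ ^ 2) / 4))) := by
  obtain ⟨h1, h2⟩ := abs_le.1 hx
  have hq0 : 0 ≤ ε * t := by positivity
  have hq1 : ε * t ≤ 1 := by nlinarith
  have hlin : |1 - ε * x| ≤ 1 - ε * t + 2 * ε := abs_le.2 ⟨by nlinarith, by nlinarith⟩
  have hexp : -2 * x + ε * x ^ 2 ≤ -t + (8 - t * (1 - ε * t)) := by
    have hd : (x - t) ^ 2 ≤ 4 := by nlinarith
    have : -2 * x + ε * x ^ 2 = -t - t * (1 - ε * t) - 2 * (x - t) * (1 - ε * t)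
        + ε * (x - t) ^ 2 := by ring
    have : ε * (x - t) ^ 2 ≤ 4 := by nlinarith
    have : -2 * (x - t) * (1 - ε * t) ≤ 4 := by nlinarith
    linarith
  rw [abs_mul, abs_exp]
  have hmain : (1 - ε * t + 2 * ε) * exp (8 - t * (1 - ε * t)) ≤
      4 * exp 8 * (exp (-t / 2) + ε * exp ((t - γ ^ 2) / 4)) := by
    rcases le_total (ε * t) (1 / 2) with hq | hq
    · calc (1 - ε * t + 2 * ε) * exp (8 - t * (1 - ε * t)) ≤ 4 * exp (8 + -t / 2) := by
            gcongr <;> nlinarith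
        _ = 4 * exp 8 * exp (-t / 2) := by rw [exp_add]; ring
        _ ≤ _ := by
            gcongr
            have : 0 ≤ ε * exp ((t - γ ^ 2) / 4) := by positivity
            linarith
    · have hz : 1 - ε * t + 2 * ε = ε * (γ ^ 2 - t + 2) := by linarith
      have hz2 : γ ^ 2 - t + 2 ≤ 4 * exp ((γ ^ 2 - t) / 4) := by
        linarith [add_one_le_exp ((γ ^ 2 - t) / 4)]
      have hz3 : t * (1 - ε * t) = ε * t * (γ ^ 2 - t) := by linear_combination -t * hε
      calc (1 - ε * t + 2 * ε) * exp (8 - t * (1 - ε * t))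
          ≤ ε * (4 * exp ((γ ^ 2 - t) / 4)) * exp (8 + (t - γ ^ 2) / 2) := by
            rw [hz]
            gcongr
            rw [hz3]
            nlinarith
        _ = 4 * exp 8 * (ε * exp ((t - γ ^ 2) / 4)) := by
            have : exp ((t - γ ^ 2) / 4) = exp ((γ ^ 2 - t) / 4) * exp ((t - γ ^ 2) / 2) := by
              rw [← exp_add]
              ring_nf
            rw [exp_add, this]
            ring
        _ ≤ _ := by
            gcongr
            have := exp_pos (-t / 2)
            linarith
  calc |1 - ε * x| * exp (-2 * x + ε * x ^ 2)
      ≤ (1 - ε * t + 2 * ε) * exp (-t + (8 - t * (1 - ε * t))) := by gcongr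
    _ = exp (-t) * ((1 - ε * t + 2 * ε) * exp (8 - t * (1 - ε * t))) := by rw [exp_add]; ring
    _ ≤ _ := by gcongr

theorem hasDerivAt_exp_neg_half_logRadius (x : ℝ) :
    HasDerivAt (fun s => exp (-logRadius s / 2))
      (exp (-logRadius x / 2) * (-(2 * x / (1 + x ^ 2)) / 2)) x :=
  ((hasDerivAt_logRadius x).neg.div_const 2).exp

theorem hasDerivAt_exp_logRadius_sub (c x : ℝ) :
    HasDerivAt (fun s => exp ((logRadius s - c) / 4))
      (exp ((logRadius x - c) / 4) * (2 * x / (1 + x ^ 2) / 4)) x :=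
  (((hasDerivAt_logRadius x).sub_const c).div_const 4).exp

/-- Outside the concentration region the mass is almost constant. -/
theorem abs_mass_sub_mass_le (h : IsNormalizedBubble ε w m) {γ a b : ℝ} (hε : ε * γ ^ 2 = 1)
    (hε0 : 0 < ε) (hε1 : ε ≤ 1) (ha : 0 ≤ a) (hab : a ≤ b)
    (hb : logRadius b ≤ γ ^ 2) (hd : ∀ s ∈ Icc a b, |w s - logRadius s| ≤ 2) :
    |m b - m a| ≤
      4 * exp 8 * (2 * exp (-logRadius a / 2) + 4 * ε * exp ((logRadius b - γ ^ 2) / 4)) := by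
  have hl := continuous_logRadius
  have key := abs_sub_le_sub_of_abs_hasDerivAt_le (f := m)
    (g := fun s => 4 * exp 8 * (-2 * exp (-logRadius s / 2)
      + 4 * ε * exp ((logRadius s - γ ^ 2) / 4))) hab
    h.continuous_right.continuousOn (by fun_prop)
    (fun x hx => h.hasDerivAt_right x (ha.trans_lt hx.1))
    (fun x _ => (((hasDerivAt_exp_neg_half_logRadius x).const_mul (-2)).add
      ((hasDerivAt_exp_logRadius_sub (γ ^ 2) x).const_mul (4 * ε))).const_mul (4 * exp 8)) (by
      intro x hx
      have hx0 : 0 < x := ha.trans_lt hx.1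
      have hG := abs_density_le hε hε0 hε1 (logRadius_nonneg x)
        ((logRadius_le_logRadius hx0.le hx.2.le).trans hb) (hd x (Ioo_subset_Icc_self hx))
      rw [exp_neg_logRadius] at hG
      rw [abs_mul, abs_of_pos (by positivity : 0 < 2 * x)]
      calc _ ≤ 2 * x * _ := mul_le_mul_of_nonneg_left hG (by positivity)
        _ = _ := by
          field_simp)
  refine key.trans ?_
  have h1 : 0 ≤ 4 * exp 8 * (2 * exp (-logRadius b / 2)) := by positivity
  have h2 : 0 ≤ 4 * exp 8 * (4 * ε * exp ((logRadius a - γ ^ 2) / 4)) := by positivity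
  linarith

/-- Outside the concentration region the bubble is almost affine in the logarithmic variable. -/
theorem abs_sub_affine_le (h : IsNormalizedBubble ε w m) {γ a b : ℝ} (hε : ε * γ ^ 2 = 1)
    (hγ : 2 ≤ γ) (hε0 : 0 < ε) (hε1 : ε ≤ 1) (ha : 1 ≤ a) (haγ : logRadius a = γ)
    (hma : |m a - 1| ≤ 1) (hab : a ≤ b)
    (hb : logRadius b ≤ γ ^ 2) (hd : ∀ s ∈ Icc a b, |w s - logRadius s| ≤ 2) :
    |w b - w a - m a * (logRadius b - γ)| ≤
      (48 * (14 * (4 * exp 8) + 4) + 16 * (4 * exp 8)) / γ := by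
  have hl := continuous_logRadius
  have hw := h.continuous_left
  set K := 4 * exp 8 with hK
  have hK0 : 0 < K := by positivity
  set E := exp (-γ / 2) with hE
  have hE0 : 0 < E := exp_pos _
  have hE1 : E ≤ 1 := exp_le_one_iff.2 (by linarith)
  have key := abs_sub_le_sub_of_abs_hasDerivAt_le (f := fun s => w s - m a * logRadius s)
    (g := fun s => (14 * K + 4) * E * logRadius s
      + 16 * K * ε * exp ((logRadius s - γ ^ 2) / 4)) hab
    (by fun_prop) (by fun_prop)
    (fun x hx => (h.hasDerivAt_left x (by linarith [hx.1])).sub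
      ((hasDerivAt_logRadius x).const_mul (m a)))
    (fun x _ => ((hasDerivAt_logRadius x).const_mul ((14 * K + 4) * E)).add
      ((hasDerivAt_exp_logRadius_sub (γ ^ 2) x).const_mul (16 * K * ε))) (by
      intro x hx
      have hx1 : 1 < x := by linarith [hx.1]
      have hx0 : 0 < x := by linarith
      have hxγ : logRadius x ≤ γ ^ 2 := (logRadius_le_logRadius hx0.le hx.2.le).trans hb
      have hγx : γ ≤ logRadius x := haγ ▸ logRadius_le_logRadius (by linarith) hx.1.le
      have hm := h.abs_mass_sub_mass_le hε hε0 hε1 (by linarith) hx.1.le hxγ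
        fun s hs => hd s ⟨hs.1, hs.2.trans hx.2.le⟩
      rw [haγ, ← hE, ← hK] at hm
      set Z := exp ((logRadius x - γ ^ 2) / 4) with hZ
      have hZ0 : 0 < Z := exp_pos _
      have hZ1 : Z ≤ 1 := exp_le_one_iff.2 (by linarith)
      have hεZ : ε * Z ≤ 1 := mul_le_one₀ hε1 hZ0.le hZ1
      have hmx : |m x| ≤ 2 + 6 * K := by
        have h1 := abs_le.1 hm
        have h2 := abs_le.1 hma
        have h3 : K * (2 * E + 4 * ε * Z) ≤ K * 6 := by gcongr; linarith
        exact abs_le.2 ⟨by linarith, by linarith⟩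
      have hinv : 1 / x ^ 2 ≤ 2 * E := by
        calc 1 / x ^ 2 ≤ 2 * (1 + x ^ 2)⁻¹ := by
              rw [← div_eq_mul_inv, div_le_div_iff₀ (by positivity) (by positivity)]
              nlinarith
          _ = 2 * exp (-logRadius x) := by rw [exp_neg_logRadius]
          _ ≤ 2 * E := by
              rw [hE]
              gcongr
              linarith
      calc _ = |2 * x / (1 + x ^ 2) * ((m x - m a) + m x * (1 / x ^ 2))| := by
            congr 1
            field_simp
            ring
        _ = 2 * x / (1 + x ^ 2) * |(m x - m a) + m x * (1 / x ^ 2)| := by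
            rw [abs_mul, abs_of_pos (by positivity : 0 < 2 * x / (1 + x ^ 2))]
        _ ≤ 2 * x / (1 + x ^ 2) * (|m x - m a| + |m x| * (1 / x ^ 2)) := by
            gcongr
            refine (abs_add_le _ _).trans_eq ?_
            rw [abs_mul, abs_of_pos (by positivity : 0 < 1 / x ^ 2)]
        _ ≤ 2 * x / (1 + x ^ 2) * (K * (2 * E + 4 * ε * Z) + (2 + 6 * K) * (2 * E)) := by
            gcongr
        _ = _ := by ring)
  have hγ0 : 0 < γ := by linarith
  have hE3 : E * γ ^ 3 ≤ 48 := by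
    have h3 := pow_div_factorial_le_exp (γ / 2) (by positivity) 3
    have h4 : E * exp (γ / 2) = 1 := by rw [hE, ← exp_add]; ring_nf; simp
    norm_num [Nat.factorial] at h3
    nlinarith
  have hZ1 : exp ((logRadius b - γ ^ 2) / 4) ≤ 1 := exp_le_one_iff.2 (by linarith)
  have hεγ : ε * γ ≤ 1 := by nlinarith
  have hEγ : E * (logRadius b - γ) * γ ≤ 48 := by
    calc E * (logRadius b - γ) * γ ≤ E * γ ^ 2 * γ := by gcongr; linarith
      _ = E * γ ^ 3 := by ring
      _ ≤ 48 := hE3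
  simp only [haγ] at key
  have hrw : w b - m a * logRadius b - (w a - m a * γ) = w b - w a - m a * (logRadius b - γ) := by
    ring
  rw [hrw] at key
  refine key.trans ?_
  rw [le_div_iff₀ hγ0]
  have h1 : 0 ≤ 16 * K * ε * exp ((γ - γ ^ 2) / 4) := by positivity
  have h2 : 16 * K * (ε * γ) * exp ((logRadius b - γ ^ 2) / 4) ≤ 16 * K := by
    have : ε * γ * exp ((logRadius b - γ ^ 2) / 4) ≤ 1 :=
      mul_le_one₀ hεγ (exp_pos _).le hZ1
    nlinarith
  have h3 := mul_le_mul_of_nonneg_left hEγ (by positivity : 0 ≤ 14 * K + 4)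
  nlinarith [mul_nonneg h1 hγ0.le]

theorem abs_sub_expansion_le (h : IsNormalizedBubble ε w m) {γ A S : ℝ} (hε : ε * γ ^ 2 = 1)
    (hγ : 2 ≤ γ) (hAdef : A = 3 * exp 12) (hεA : 10 * (ε * A) ≤ 1) (hε0 : 0 < ε)
    (hS0 : 0 ≤ S) (hS : logRadius S ≤ γ ^ 2) (hd : ∀ s ∈ Icc 0 S, |w s - logRadius s| ≤ 2)
    (hγA : 114 * A * exp 8 + 4 + (6 * A + 2) ^ 2 ≤ γ) :
    |w S - logRadius S - ε * logRadius S| ≤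
      (48 * (14 * (4 * exp 8) + 4) + 16 * (4 * exp 8) + 6 * A
        + (114 * A * exp 8 + 4 + (6 * A + 2) ^ 2) + 1) / γ := by
  have hA : 1 ≤ A := by
    rw [hAdef]
    linarith [one_le_exp (show (0 : ℝ) ≤ 12 by norm_num)]
  have hA0 : 0 ≤ A := by linarith
  have hγ0 : 0 < γ := by linarith
  have hεγ : ε = 1 / γ ^ 2 := by field_simp; exact hε
  have hεγ' : ε * γ = 1 / γ := by rw [hεγ]; field_simp
  have hε1 : ε ≤ 1 := by nlinarith
  have hI : ∀ s ∈ Icc 0 S, logRadius s ≤ γ →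
      |bubbleMoment ε w s| ≤ A * bubbleEnergy ε w s := fun s hs hsγ => by
    rw [hAdef]
    exact abs_moment_le h.continuous_left hε hγ hs.1 hsγ fun x hx => hd x ⟨hx.1, hx.2.trans hs.2⟩
  have hinner : ∀ s ∈ Icc 0 S, logRadius s ≤ γ → |w s - logRadius s| ≤ 6 * A / γ := by
    intro s hs hsγ
    have := h.abs_sub_logRadius_le hε0.le hA0 hεA hs.1 fun x hx =>
      hI x ⟨hx.1, hx.2.trans hs.2⟩ ((logRadius_le_logRadius hx.1 hx.2).trans hsγ)
    calc _ ≤ 6 * (ε * A) * logRadius s := this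
      _ ≤ 6 * (ε * A) * γ := by gcongr
      _ = 6 * A * (ε * γ) := by ring
      _ = 6 * A / γ := by rw [hεγ']; ring
  set C₁ := 114 * A * exp 8 + 4 + (6 * A + 2) ^ 2 with hC₁
  set C₂ := 48 * (14 * (4 * exp 8) + 4) + 16 * (4 * exp 8) with hC₂
  have hC₁0 : 0 ≤ C₁ := by positivity
  have hC₂0 : 0 ≤ C₂ := by positivity
  rw [add_div, add_div, add_div]
  have hC₁γ : 0 ≤ C₁ / γ := by positivity
  have hC₂γ : 0 ≤ C₂ / γ := by positivity
  rcases le_total (logRadius S) γ with hSγ | hSγ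
  · have h1 := abs_le.1 (hinner S ⟨hS0, le_rfl⟩ hSγ)
    have h2 : ε * logRadius S ≤ 1 / γ := by rw [← hεγ']; gcongr
    have h3 : 0 ≤ ε * logRadius S := mul_nonneg hε0.le (logRadius_nonneg S)
    exact abs_le.2 ⟨by linarith, by linarith⟩
  · obtain ⟨a, ha, haγ⟩ := intermediate_value_Icc hS0 continuous_logRadius.continuousOn
      (⟨by rw [logRadius_zero]; exact hγ0.le, hSγ⟩ : γ ∈ Icc (logRadius 0) (logRadius S))
    have ha1 : 1 ≤ a := by
      by_contra! hlt
      have h1 := exp_logRadius a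
      have h2 := add_one_le_exp γ
      rw [haγ] at h1
      nlinarith [ha.1]
    have hda : ∀ s ∈ Icc 0 a, |w s - logRadius s| ≤ 2 := fun s hs => hd s ⟨hs.1, hs.2.trans ha.2⟩
    have hmass := h.abs_mass_sub_one_sub_le hε hγ hA hεA hε0 (by linarith) haγ hda
      fun s hs => hI s ⟨hs.1, hs.2.trans ha.2⟩ ((logRadius_le_logRadius hs.1 hs.2).trans haγ.le)
    rw [← hC₁] at hmass
    have hε4 : ε ≤ 1 / 4 := by nlinarith
    have hma : |m a - 1| ≤ 1 := by
      have h1 : C₁ * (ε / γ) ≤ ε := by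
        rw [mul_div_assoc', div_le_iff₀ hγ0, mul_comm]
        gcongr
      have h2 := abs_le.1 hmass
      exact abs_le.2 ⟨by linarith, by linarith⟩
    have houter := h.abs_sub_affine_le hε hγ hε0 hε1 ha1 haγ hma ha.2 hS
      fun s hs => hd s ⟨ha.1.trans hs.1, hs.2⟩
    rw [← hC₂] at houter
    have hwa := hinner a ha haγ.le
    rw [haγ] at hwa
    have hslope : |(m a - 1 - ε) * (logRadius S - γ)| ≤ C₁ / γ := by
      rw [abs_mul, abs_of_nonneg (by linarith : 0 ≤ logRadius S - γ)]
      calc _ ≤ C₁ * (ε / γ) * γ ^ 2 := by gcongr; linarith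
        _ = C₁ * (ε * γ ^ 2) / γ := by ring
        _ = C₁ / γ := by rw [hε, mul_one]
    have h1 := abs_le.1 houter
    have h2 := abs_le.1 hwa
    have h3 := abs_le.1 hslope
    have hid : w S - logRadius S - ε * logRadius S =
        (w S - w a - m a * (logRadius S - γ)) + (w a - γ)
          + (m a - 1 - ε) * (logRadius S - γ) - ε * γ := by ring
    have h4 : 0 < 1 / γ := by positivity
    rw [hid, hεγ']
    exact abs_le.2 ⟨by linarith, by linarith⟩

/-- Uniform expansion of normalized bubbles. -/
theorem exists_abs_sub_expansion_le : ∃ C : ℝ, 2 ≤ C ∧ ∀ {γ ε : ℝ} {w m : ℝ → ℝ},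
    IsNormalizedBubble ε w m → ε * γ ^ 2 = 1 → C ≤ γ → ∀ S, 0 ≤ S → logRadius S ≤ γ ^ 2 →
      |w S - logRadius S - ε * logRadius S| ≤ C / γ := by
  obtain ⟨A, hAdef⟩ : ∃ A, A = 3 * exp 12 := ⟨_, rfl⟩
  have hA : 1 ≤ A := by
    rw [hAdef]
    linarith [one_le_exp (show (0 : ℝ) ≤ 12 by norm_num)]
  set C₁ := 114 * A * exp 8 + 4 + (6 * A + 2) ^ 2 with hC₁
  set C₂ := 48 * (14 * (4 * exp 8) + 4) + 16 * (4 * exp 8) with hC₂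
  have hC₁0 : 4 + 10 * A ≤ C₁ := by
    have : 0 < 114 * A * exp 8 := by positivity
    nlinarith
  have hC₂0 : 0 ≤ C₂ := by positivity
  refine ⟨2 * (C₂ + 6 * A + C₁ + 1), by linarith, ?_⟩
  intro γ ε w m h hε hCγ S hS0 hS
  have hγ : 2 ≤ γ := by linarith
  have hγ0 : 0 < γ := by linarith
  have hε0 : 0 < ε := by
    by_contra! hneg
    nlinarith [sq_nonneg γ]
  have hεA : 10 * (ε * A) ≤ 1 := by nlinarith
  have hexp : ∀ T, 0 ≤ T → logRadius T ≤ γ ^ 2 → (∀ s ∈ Icc 0 T, |w s - logRadius s| ≤ 2) →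
      |w T - logRadius T - ε * logRadius T| ≤ (C₂ + 6 * A + C₁ + 1) / γ := fun T hT0 hT hd =>
    h.abs_sub_expansion_le hε hγ hAdef hεA hε0 hT0 hT hd (by linarith)
  have hd : ∀ s ∈ Icc 0 S, |w s - logRadius s| ≤ 2 := by
    refine le_of_bootstrap
      ((h.continuous_left.sub continuous_logRadius).abs) (by simp [h.left_zero, logRadius_zero]) ?_
    intro T hT hdT
    have hTγ : logRadius T ≤ γ ^ 2 := (logRadius_le_logRadius hT.1 hT.2).trans hS
    have h1 := abs_le.1 (hexp T hT.1 hTγ hdT)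
    have h2 : (C₂ + 6 * A + C₁ + 1) / γ ≤ 1 / 2 := by
      rw [div_le_iff₀ hγ0]
      linarith
    have h3 : ε * logRadius T ≤ 1 := by nlinarith
    have h4 : 0 ≤ ε * logRadius T := mul_nonneg hε0.le (logRadius_nonneg T)
    exact abs_lt.2 ⟨by linarith, by linarith⟩
  refine (hexp S hS0 hS hd).trans ?_
  gcongr
  linarith

end IsNormalizedBubble

theorem isNormalizedBubble_of_standard_bubble {γ μ : ℝ} (hγ : 0 < γ) (hμ : 0 < μ) {B : ℝ → ℝ}
    (hB : ContDiff ℝ (⊤ : ℕ∞) B) (hB0 : B 0 = γ)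
    (hode : ∀ r > (0 : ℝ), deriv (deriv B) r + deriv B r / r
      = -((μ ^ 2)⁻¹ * (γ ^ 2)⁻¹ * B r * Real.exp ((B r) ^ 2 - γ ^ 2))) :
    IsNormalizedBubble (γ ^ 2)⁻¹ (fun s => γ ^ 2 - γ * B (2 * μ * s))
      (fun s => -(μ * γ * (s * deriv B (2 * μ * s)))) := by
  have hB' : ContDiff ℝ (⊤ : ℕ∞) (deriv B) := (contDiff_infty_iff_deriv.1 hB).2
  have hcB := hB.continuous
  have hcB' := hB'.continuous
  have hscale : ∀ s : ℝ, HasDerivAt (fun s => 2 * μ * s) (2 * μ) s := fun s => by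
    simpa using (hasDerivAt_id s).const_mul (2 * μ)
  have hd : ∀ s, HasDerivAt (fun s => B (2 * μ * s)) (deriv B (2 * μ * s) * (2 * μ)) s := fun s =>
    ((hB.differentiable (by simp)) _).hasDerivAt.comp s (hscale s)
  have hd' : ∀ s, HasDerivAt (fun s => deriv B (2 * μ * s))
      (deriv (deriv B) (2 * μ * s) * (2 * μ)) s := fun s =>
    ((hB'.differentiable (by simp)) _).hasDerivAt.comp s (hscale s)
  refine ⟨by fun_prop, by fun_prop, by simp [hB0, sq], by simp, fun s hs => ?_, fun s hs => ?_⟩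
  · refine (((hd s).const_mul γ).const_sub (γ ^ 2)).congr_deriv ?_
    field_simp
  · refine ((((hasDerivAt_id s).mul (hd' s)).const_mul (μ * γ)).neg).congr_deriv ?_
    have hr := hode (2 * μ * s) (by positivity)
    have hexp : -2 * (γ ^ 2 - γ * B (2 * μ * s)) + (γ ^ 2)⁻¹ * (γ ^ 2 - γ * B (2 * μ * s)) ^ 2 =
        B (2 * μ * s) ^ 2 - γ ^ 2 := by
      field_simp
      ring
    rw [hexp]
    have hr' : deriv (deriv B) (2 * μ * s) = -((μ ^ 2)⁻¹ * (γ ^ 2)⁻¹ * B (2 * μ * s) *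
        Real.exp ((B (2 * μ * s)) ^ 2 - γ ^ 2)) - deriv B (2 * μ * s) / (2 * μ * s) := by
      linarith
    rw [hr']
    simp only [id]
    field_simp
    ring

/-- **pointwise expansion of the standard bubble.** -/
theorem stmt18 :
    ∃ C₀ : ℝ, 0 < C₀ ∧ ∃ γ₀ : ℝ, 0 < γ₀ ∧
      ∀ γ : ℝ, γ₀ ≤ γ → ∀ μ : ℝ, 0 < μ → ∀ B : ℝ → ℝ,
        ContDiff ℝ (⊤ : ℕ∞) B → B 0 = γ → deriv B 0 = 0 →
        (∀ r > (0 : ℝ), deriv (deriv B) r + deriv B r / r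
          = -((μ ^ 2)⁻¹ * (γ ^ 2)⁻¹ * B r * Real.exp ((B r) ^ 2 - γ ^ 2))) →
        ∀ r : ℝ, 0 ≤ r → Real.log (1 + r ^ 2 / (4 * μ ^ 2)) ≤ γ ^ 2 →
          |B r - (γ - Real.log (1 + r ^ 2 / (4 * μ ^ 2)) / γ
            - Real.log (1 + r ^ 2 / (4 * μ ^ 2)) / γ ^ 3)| ≤ C₀ / γ ^ 2 := by
  obtain ⟨C, hC, hmain⟩ := IsNormalizedBubble.exists_abs_sub_expansion_le
  refine ⟨C, by linarith, C, by linarith, ?_⟩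
  intro γ hγ μ hμ B hB hB0 _ hode r hr hrγ
  have hγ0 : 0 < γ := by linarith
  have ht : Real.log (1 + r ^ 2 / (4 * μ ^ 2)) = logRadius (r / (2 * μ)) := by
    rw [logRadius, div_pow, mul_pow]
    norm_num
  rw [ht] at hrγ ⊢
  have key := hmain (isNormalizedBubble_of_standard_bubble hγ0 hμ hB hB0 hode)
    (by field_simp) hγ (r / (2 * μ)) (by positivity) hrγ
  have hrr : 2 * μ * (r / (2 * μ)) = r := by field_simp
  simp only [hrr] at key
  set t := logRadius (r / (2 * μ)) with ht_def
  have hid : B r - (γ - t / γ - t / γ ^ 3) =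
      -((γ ^ 2 - γ * B r - t - (γ ^ 2)⁻¹ * t) / γ) := by
    field_simp
    ring
  have hdiv : C / γ ^ 2 = C / γ / γ := by rw [sq, div_div]
  rw [hid, hdiv, abs_neg, abs_div, abs_of_pos hγ0]
  gcongr

end
end

section
/- There exist C₁ > 0 and γ₀ > 0 such that for every γ ≥ γ₀, every μ > 0, and every smooth B : [0,∞) → ℝ satisfying B(0) = γ, B'(0) = 0 and B''(r) + B'(r)/r = −μ⁻² γ⁻² B(r) e^{B(r)² − γ²} for r > 0, the function b(t) := B(2μ√(eᵗ − 1)) (the bubble expressed in the variable t = ln(1 + r²/(4μ²))) satisfies |b'(t) + γ⁻¹| ≤ C₁ γ⁻² for all 0 < t ≤ γ². -/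
open Set Filter Topology Real

noncomputable section

theorem le_of_hasDerivAt_nonneg {f f' : ℝ → ℝ} {a b : ℝ} (hab : a ≤ b)
    (hc : ContinuousOn f (Icc a b)) (hd : ∀ x ∈ Ioo a b, HasDerivAt f (f' x) x)
    (hf : ∀ x ∈ Ioo a b, 0 ≤ f' x) : f a ≤ f b := by
  rcases hab.eq_or_lt with rfl | hlt
  · exact le_rfl
  obtain ⟨c, hc1, hc2⟩ := exists_hasDerivAt_eq_slope f f' hlt hc hd
  have h := hf c hc1
  rw [hc2, le_div_iff₀ (sub_pos.2 hlt)] at h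
  linarith

theorem abs_sub_le_of_hasDerivAt {f f' : ℝ → ℝ} {a b C : ℝ} (hab : a ≤ b)
    (hc : ContinuousOn f (Icc a b)) (hd : ∀ x ∈ Ioo a b, HasDerivAt f (f' x) x)
    (hf : ∀ x ∈ Ioo a b, |f' x| ≤ C) : |f b - f a| ≤ C * (b - a) := by
  rcases hab.eq_or_lt with rfl | hlt
  · simp
  obtain ⟨c, hc1, hc2⟩ := exists_hasDerivAt_eq_slope f f' hlt hc hd
  have h := hf c hc1
  rwa [hc2, abs_div, abs_of_pos (sub_pos.2 hlt), div_le_iff₀ (sub_pos.2 hlt)] at h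

/-- The rescaled nonlinearity `e^{t - 2z + ε z²}` of the bubble equation. -/
def bubbleDensity (ε : ℝ) (z : ℝ → ℝ) (t : ℝ) : ℝ := exp (t - 2 * z t + ε * z t ^ 2)

/-- The first order system for `z = γ (γ - b)` and `y = z' - 1`, with `ε = γ⁻²`, together with the
a priori bound `|y| ≤ δ` on `(0, T)`. -/
structure BubbleSystem (ε δ T : ℝ) (z y y' : ℝ → ℝ) : Prop where
  contZ : Continuous z
  contY : Continuous y
  z_zero : z 0 = 0
  y_zero : y 0 = 0
  derivZ : ∀ t, 0 < t → HasDerivAt z (1 + y t) t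
  derivY : ∀ t, 0 < t → HasDerivAt y (y' t) t
  eqn : ∀ t, 0 < t →
    (1 - exp (-t)) * y' t = -exp (-t) * (1 + y t) + (1 - ε * z t) * bubbleDensity ε z t
  bound : ∀ t ∈ Ioo 0 T, |y t| ≤ δ

theorem div_one_add_le_one_sub_exp_neg {t : ℝ} (ht : 0 ≤ t) : t / (1 + t) ≤ 1 - exp (-t) := by
  have h1 : exp (-t) ≤ 1 / (1 + t) := by
    rw [exp_neg, ← one_div]
    exact one_div_le_one_div_of_le (by linarith) (by linarith [add_one_le_exp t])
  have h2 : t / (1 + t) = 1 - 1 / (1 + t) := by field_simp; ring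
  linarith

namespace BubbleSystem

variable {ε δ T : ℝ} {z y y' : ℝ → ℝ}

theorem abs_z_sub_le (S : BubbleSystem ε δ T z y y') {a t η : ℝ} (ha : 0 ≤ a) (hat : a ≤ t)
    (hη : ∀ s ∈ Ioo a t, |y s| ≤ η) : |(z t - t) - (z a - a)| ≤ η * (t - a) := by
  refine abs_sub_le_of_hasDerivAt (f := fun t => z t - t) (f' := y) hat
    (S.contZ.sub continuous_id).continuousOn (fun x hx => ?_) hη
  have := (S.derivZ x (ha.trans_lt hx.1)).sub (hasDerivAt_id x)
  exact this.congr_deriv (by ring)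

theorem abs_z_sub_self_le (S : BubbleSystem ε δ T z y y') {t : ℝ} (h0 : 0 ≤ t) (ht : t ≤ T) :
    |z t - t| ≤ δ * t := by
  have := S.abs_z_sub_le le_rfl h0 (fun s hs => S.bound s ⟨hs.1, hs.2.trans_le ht⟩)
  simpa [S.z_zero] using this

theorem density_le (S : BubbleSystem ε δ T z y y') (hεδ : ε = δ ^ 2) (hδ : 0 < δ)
    (hδ4 : δ ≤ 1 / 4) (hT : ε * T ≤ 1) {t : ℝ} (h0 : 0 ≤ t) (ht : t ≤ T) :
    bubbleDensity ε z t ≤ exp (1 - t * (1 - ε * t) / 2) := by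
  have hv := abs_le.1 (S.abs_z_sub_self_le h0 ht)
  set v := z t - t with hvdef
  have hz : z t = t + v := by rw [hvdef]; ring
  have hε : 0 < ε := by rw [hεδ]; positivity
  have hεt : ε * t ≤ 1 := (mul_le_mul_of_nonneg_left ht hε.le).trans hT
  refine exp_le_exp.2 ?_
  rw [hz]
  have h1 : v ^ 2 ≤ (δ * t) ^ 2 := sq_le_sq' hv.1 hv.2
  have h2 : ε * v ^ 2 ≤ (ε * t) ^ 2 := by
    calc ε * v ^ 2 ≤ ε * (δ * t) ^ 2 := by gcongr
      _ = (ε * t) ^ 2 := by rw [hεδ]; ring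
  have h3 : (ε * t) ^ 2 ≤ 1 := pow_le_one₀ (by positivity) hεt
  have h4 : -v ≤ t / 4 := by nlinarith [hv.1]
  have h5 : -v * (1 - ε * t) ≤ t / 4 * (1 - ε * t) :=
    mul_le_mul_of_nonneg_right h4 (by linarith)
  nlinarith

theorem z_mem (S : BubbleSystem ε δ T z y y') (hδ4 : δ ≤ 1 / 4)
    {t : ℝ} (h0 : 0 ≤ t) (ht : t ≤ T) : 0 ≤ z t ∧ z t ≤ 2 * t := by
  have hv := abs_le.1 (S.abs_z_sub_self_le h0 ht)
  constructor <;> nlinarith [hv.1, hv.2]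

/-- The Pohozaev-type quantity of the bubble equation, whose derivative is `ε z e^{t-2z+εz²}`. -/
def pohozaev (ε : ℝ) (z y : ℝ → ℝ) (t : ℝ) : ℝ :=
  ((1 - exp (-t)) * (1 + y t)) ^ 2 - (1 - exp (-t)) * (1 + y t)
    + (1 - exp (-t)) * bubbleDensity ε z t

theorem hasDerivAt_density (S : BubbleSystem ε δ T z y y') {t : ℝ} (h0 : 0 < t) :
    HasDerivAt (bubbleDensity ε z)
      (bubbleDensity ε z t * (1 - 2 * (1 - ε * z t) * (1 + y t))) t := by
  have hz := S.derivZ t h0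
  have := (((hasDerivAt_id t).sub (hz.const_mul 2)).add ((hz.pow 2).const_mul ε)).exp
  refine this.congr_deriv ?_
  simp [bubbleDensity]
  ring

theorem hasDerivAt_pohozaev (S : BubbleSystem ε δ T z y y') {t : ℝ} (h0 : 0 < t) :
    HasDerivAt (pohozaev ε z y) (ε * z t * bubbleDensity ε z t) t := by
  have ha : HasDerivAt (fun t : ℝ => 1 - exp (-t)) (exp (-t)) t := by
    have := (hasDerivAt_id t).neg.exp.const_sub 1
    exact this.congr_deriv (by simp)
  have hP := ha.mul ((S.derivY t h0).const_add 1)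
  have := ((hP.pow 2).sub hP).add (ha.mul (S.hasDerivAt_density h0))
  refine this.congr_deriv ?_
  have e := S.eqn t h0
  simp only [Pi.mul_apply]
  push_cast
  linear_combination (2 * ((1 - exp (-t)) * (1 + y t)) - 1) * e

theorem continuous_density (S : BubbleSystem ε δ T z y y') : Continuous (bubbleDensity ε z) := by
  have := S.contZ
  unfold bubbleDensity
  fun_prop

theorem continuous_pohozaev (S : BubbleSystem ε δ T z y y') : Continuous (pohozaev ε z y) := by
  have := S.contY
  have := S.continuous_density
  unfold pohozaev
  fun_prop

theorem density_le_three (S : BubbleSystem ε δ T z y y') (hεδ : ε = δ ^ 2) (hδ : 0 < δ)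
    (hδ4 : δ ≤ 1 / 4) (hT : ε * T ≤ 1) {t : ℝ} (h0 : 0 ≤ t) (ht : t ≤ T) :
    bubbleDensity ε z t ≤ 3 := by
  have hε : 0 < ε := by rw [hεδ]; positivity
  have hεt : ε * t ≤ 1 := (mul_le_mul_of_nonneg_left ht hε.le).trans hT
  refine (S.density_le hεδ hδ hδ4 hT h0 ht).trans ?_
  refine (exp_le_exp.2 ?_).trans (exp_one_lt_d9.le.trans (by norm_num))
  nlinarith [mul_nonneg h0 (sub_nonneg.2 hεt)]

theorem pohozaev_mem (S : BubbleSystem ε δ T z y y') (hεδ : ε = δ ^ 2) (hδ : 0 < δ)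
    (hδ4 : δ ≤ 1 / 4) (hT : ε * T ≤ 1) {t : ℝ} (h0 : 0 ≤ t) (ht : t ≤ T) :
    0 ≤ pohozaev ε z y t ∧ pohozaev ε z y t ≤ 3 * ε * t ^ 2 := by
  have hε : 0 < ε := by rw [hεδ]; positivity
  have hzero : pohozaev ε z y 0 = 0 := by simp [pohozaev]
  constructor
  · rw [← hzero]
    refine le_of_hasDerivAt_nonneg h0 S.continuous_pohozaev.continuousOn
      (fun x hx => S.hasDerivAt_pohozaev hx.1) (fun x hx => ?_)
    have := (S.z_mem hδ4 hx.1.le (hx.2.le.trans ht)).1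
    have : 0 < bubbleDensity ε z x := exp_pos _
    positivity
  · have := le_of_hasDerivAt_nonneg (f := fun t => 3 * ε * t ^ 2 - pohozaev ε z y t)
      (f' := fun t => 3 * ε * (2 * t) - ε * z t * bubbleDensity ε z t) h0
      ((by fun_prop : Continuous fun t : ℝ => 3 * ε * t ^ 2).sub
        S.continuous_pohozaev).continuousOn
      (fun x hx => by
        refine HasDerivAt.sub ?_ (S.hasDerivAt_pohozaev hx.1)
        exact (((hasDerivAt_id x).pow 2).const_mul (3 * ε)).congr_deriv (by simp))
      (fun x hx => by
        have hz := S.z_mem hδ4 hx.1.le (hx.2.le.trans ht)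
        have hH := S.density_le_three hεδ hδ hδ4 hT hx.1.le (hx.2.le.trans ht)
        have hH0 : 0 < bubbleDensity ε z x := exp_pos _
        have : z x * bubbleDensity ε z x ≤ 2 * x * 3 := by
          have := hx.1
          gcongr
          exact hz.2
        nlinarith)
    simp only [hzero] at this
    norm_num at this
    linarith

/-- The equation for `y`, in the form which exhibits the stability of `y = 0`. -/
theorem abs_deriv_add_le (S : BubbleSystem ε δ T z y y') (hεδ : ε = δ ^ 2) (hδ : 0 < δ)
    (hδ4 : δ ≤ 1 / 4) (hT : ε * T ≤ 1) {t : ℝ} (h0 : 0 < t) (ht : t ≤ T) :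
    |y' t + y t * (1 + y t)| ≤ 6 * ε * (1 + t) ^ 2 := by
  have hε : 0 < ε := by rw [hεδ]; positivity
  have hQ := S.pohozaev_mem hεδ hδ hδ4 hT h0.le ht
  have hz := S.z_mem hδ4 h0.le ht
  have hH := S.density_le_three hεδ hδ hδ4 hT h0.le ht
  have hH0 : 0 < bubbleDensity ε z t := exp_pos _
  have ha := div_one_add_le_one_sub_exp_neg h0.le
  have e := S.eqn t h0
  rw [pohozaev] at hQ
  set a := 1 - exp (-t) with hadef
  have hexp : exp (-t) = 1 - a := by rw [hadef]; ring
  rw [hexp] at e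
  have ha0 : 0 < a := (by positivity : 0 < t / (1 + t)).trans_le ha
  rw [div_le_iff₀ (by linarith)] at ha
  set H := bubbleDensity ε z t
  set Q := (a * (1 + y t)) ^ 2 - a * (1 + y t) + a * H with hQdef
  have key : a ^ 2 * (y' t + y t * (1 + y t)) = Q - ε * z t * a * H := by
    rw [hQdef]
    linear_combination a * e
  have hsq : t ^ 2 ≤ a ^ 2 * (1 + t) ^ 2 := by
    rw [← mul_pow]; gcongr
  have hzH : z t * H ≤ 2 * t * 3 := by
    gcongr
    exact hz.2
  have h1 : ε * z t * a * H ≤ 6 * ε * (a ^ 2 * (1 + t) ^ 2) := by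
    have h2 : z t * H ≤ 6 * (a * (1 + t)) := by linarith
    have h3 : a * (1 + t) ≤ a * (1 + t) ^ 2 := by
      nlinarith [mul_pos ha0 h0, mul_pos ha0 (pow_pos h0 2)]
    calc ε * z t * a * H = ε * a * (z t * H) := by ring
      _ ≤ ε * a * (6 * (a * (1 + t) ^ 2)) :=
          mul_le_mul_of_nonneg_left (by linarith) (by positivity)
      _ = _ := by ring
  have h2 : 0 ≤ ε * z t * a * H := by have := hz.1; positivity
  have h4 : Q ≤ 6 * ε * (a ^ 2 * (1 + t) ^ 2) := by
    nlinarith [mul_le_mul_of_nonneg_left hsq hε.le, mul_pos hε (pow_pos h0 2)]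
  have h5 : a ^ 2 * |y' t + y t * (1 + y t)| ≤ a ^ 2 * (6 * ε * (1 + t) ^ 2) := by
    rw [← abs_of_pos (pow_pos ha0 2), ← abs_mul, abs_of_pos (pow_pos ha0 2), key, abs_le]
    constructor <;> linarith [hQ.1]
  exact le_of_mul_le_mul_left h5 (pow_pos ha0 2)

theorem abs_y_le_initial (S : BubbleSystem ε δ T z y y') (hεδ : ε = δ ^ 2) (hδ : 0 < δ)
    (hδ4 : δ ≤ 1 / 4) (hT : ε * T ≤ 1) {t : ℝ} (h0 : 0 ≤ t) (ht : t ≤ T) :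
    |y t| ≤ 12 * ε * (1 + t) ^ 2 := by
  have hε : 0 < ε := by rw [hεδ]; positivity
  set G := 6 * ε * (1 + t) ^ 2 with hG
  have hG0 : 0 ≤ G := by positivity
  have hcY := S.contY
  have := le_of_hasDerivAt_nonneg (f := fun s => exp (s / 2) * (2 * G ^ 2 - y s ^ 2))
    (f' := fun s => exp (s / 2) * ((2 * G ^ 2 - y s ^ 2) / 2 - 2 * y s * y' s)) h0
    (by fun_prop)
    (fun x hx => by
      have h1 := ((hasDerivAt_id x).div_const 2).exp
      have h2 := ((S.derivY x hx.1).pow 2).const_sub (2 * G ^ 2)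
      refine (h1.mul h2).congr_deriv ?_
      simp
      ring)
    (fun x hx => by
      refine mul_nonneg (exp_pos _).le ?_
      have hb := abs_le.1 (S.bound x ⟨hx.1, hx.2.trans_le ht⟩)
      have hg := S.abs_deriv_add_le hεδ hδ hδ4 hT hx.1 (hx.2.le.trans ht)
      have hgG : 6 * ε * (1 + x) ^ 2 ≤ G := by
        have := hx.1
        have := hx.2
        rw [hG]
        gcongr
      have hg2 := sq_le_sq' (abs_le.1 (hg.trans hgG)).1 (abs_le.1 (hg.trans hgG)).2
      set g := y' x + y x * (1 + y x) with hgdef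
      have : y' x = g - y x * (1 + y x) := by rw [hgdef]; ring
      rw [this]
      nlinarith [sq_nonneg (g - y x), mul_nonneg (sq_nonneg (y x)) (by linarith : 0 ≤ 1 / 4 + y x)])
  simp only [S.y_zero] at this
  have h3 : 0 ≤ exp (t / 2) * (2 * G ^ 2 - y t ^ 2) := by
    refine le_trans ?_ this
    rw [zero_pow two_ne_zero, sub_zero]
    positivity
  have h4 := nonneg_of_mul_nonneg_right h3 (exp_pos _)
  rw [show 12 * ε * (1 + t) ^ 2 = 2 * G by rw [hG]; ring]
  exact abs_le_of_sq_le_sq (by nlinarith) (by positivity)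

theorem abs_deriv_le (S : BubbleSystem ε δ T z y y') (hδ4 : δ ≤ 1 / 4) {t : ℝ} (h1 : 1 ≤ t)
    (ht : t < T) :
    |y' t| ≤ 4 * exp (-t) + 2 * (|1 - ε * z t| * bubbleDensity ε z t) := by
  have h0 : 0 < t := by linarith
  have ha := div_one_add_le_one_sub_exp_neg h0.le
  have ha2 : 1 / 2 ≤ 1 - exp (-t) := by
    refine le_trans ?_ ha
    rw [div_le_div_iff₀ (by norm_num) (by linarith)]
    linarith
  have hH0 : 0 < bubbleDensity ε z t := exp_pos _
  have hy := abs_le.1 ((S.bound t ⟨h0, ht⟩).trans hδ4)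
  have h2 : |(1 - exp (-t)) * y' t| ≤ 2 * exp (-t) + |1 - ε * z t| * bubbleDensity ε z t := by
    rw [S.eqn t h0]
    refine (abs_add_le _ _).trans ?_
    rw [abs_mul, abs_mul, abs_neg, abs_of_pos (exp_pos _), abs_of_pos hH0]
    have : |1 + y t| ≤ 2 := by rw [abs_le]; constructor <;> linarith
    nlinarith [exp_pos (-t)]
  rw [abs_mul, abs_of_pos (by linarith)] at h2
  nlinarith [abs_nonneg (y' t)]

theorem abs_y_lt {L : ℝ} (hL : 1000 ≤ L) (hexp : 10 * L ^ 14 * exp (-(L / 4)) ≤ 1)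
    (S : BubbleSystem (1 / L ^ 8) (1 / L ^ 4) T z y y') (hT : T ≤ L ^ 8) {t : ℝ} (h0 : 0 ≤ t)
    (ht : t ≤ T) : |y t| < 1 / L ^ 4 := by
  have hL0 : 0 < L := by linarith
  have hδ : 0 < 1 / L ^ 4 := by positivity
  have hεδ : 1 / L ^ 8 = (1 / L ^ 4) ^ 2 := by field_simp
  have hL4 : L ≤ L ^ 4 := le_self_pow₀ (by linarith) (by norm_num)
  have hL8 : L ≤ L ^ 8 := le_self_pow₀ (by linarith) (by norm_num)
  have hδ4 : 1 / L ^ 4 ≤ 1 / 4 := one_div_le_one_div_of_le (by norm_num) (by linarith)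
  have hεT : 1 / L ^ 8 * T ≤ 1 := by
    rw [one_div, inv_mul_le_iff₀ (by positivity)]
    linarith
  have hexp' : exp (-(L / 4)) ≤ 1 / (10 * L ^ 14) := by
    rw [le_div_iff₀ (by positivity)]
    linarith
  have hsmall : ∀ s, 0 ≤ s → s ≤ T → s ≤ L → |y s| ≤ 48 / L ^ 6 := by
    intro s hs0 hsT hsL
    refine (S.abs_y_le_initial hεδ hδ hδ4 hεT hs0 hsT).trans ?_
    calc 12 * (1 / L ^ 8) * (1 + s) ^ 2 ≤ 12 * (1 / L ^ 8) * (2 * L) ^ 2 := by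
          gcongr
          linarith
      _ = 48 / L ^ 6 := by field_simp; norm_num
  have hmid : ∀ s, 0 ≤ s → s ≤ T → s ≤ L ^ 8 - L → |y s| ≤ 49 / L ^ 6 := by
    intro s hs0 hsT hsL
    rcases le_total s L with h | h
    · refine (hsmall s hs0 hsT h).trans ?_
      gcongr
      norm_num
    have hy := abs_sub_le_of_hasDerivAt (C := 1 / L ^ 14) h S.contY.continuousOn
      (fun x hx => S.derivY x (hL0.trans hx.1)) (fun x hx => by
        have hx0 : 0 < x := hL0.trans hx.1
        have hxT : x < T := hx.2.trans_le hsT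
        refine (S.abs_deriv_le hδ4 (by linarith [hx.1]) hxT).trans ?_
        have hz := S.z_mem hδ4 hx0.le hxT.le
        have hεz : 1 / L ^ 8 * z x ≤ 2 := by
          have : 1 / L ^ 8 * z x ≤ 1 / L ^ 8 * (2 * T) := by gcongr; linarith
          linarith
        have hεz0 : 0 ≤ 1 / L ^ 8 * z x := mul_nonneg (by positivity) hz.1
        have hab : |1 - 1 / L ^ 8 * z x| ≤ 1 := by rw [abs_le]; constructor <;> linarith
        have hquad : L / 2 ≤ x * (1 - 1 / L ^ 8 * x) := by
          have e1 : x * (1 - 1 / L ^ 8 * x) = (x * (L ^ 8 - x)) / L ^ 8 := by field_simp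
          rw [e1, le_div_iff₀ (by positivity)]
          have : 0 ≤ (x - L) * (L ^ 8 - L - x) :=
            mul_nonneg (by linarith [hx.1]) (by linarith [hx.2])
          have h2L : 2 * L ≤ L ^ 8 := by
            have : L ^ 2 ≤ L ^ 8 := pow_le_pow_right₀ (by linarith) (by norm_num)
            nlinarith
          nlinarith
        have hH : bubbleDensity (1 / L ^ 8) z x ≤ 3 * exp (-(L / 4)) := by
          refine (S.density_le hεδ hδ hδ4 hεT hx0.le hxT.le).trans ?_
          calc exp (1 - x * (1 - 1 / L ^ 8 * x) / 2) ≤ exp (1 + -(L / 4)) :=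
                exp_le_exp.2 (by linarith)
            _ = exp 1 * exp (-(L / 4)) := exp_add _ _
            _ ≤ 3 * exp (-(L / 4)) := by
                gcongr
                exact exp_one_lt_d9.le.trans (by norm_num)
        have hxe : exp (-x) ≤ exp (-(L / 4)) := exp_le_exp.2 (by linarith [hx.1])
        have hH0 : 0 < bubbleDensity (1 / L ^ 8) z x := exp_pos _
        have hprod : |1 - 1 / L ^ 8 * z x| * bubbleDensity (1 / L ^ 8) z x
            ≤ 1 * (3 * exp (-(L / 4))) := by gcongr
        have : 10 * exp (-(L / 4)) ≤ 1 / L ^ 14 := by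
          rw [le_div_iff₀ (by positivity)]
          linarith
        linarith)
    have h1 : 1 / L ^ 14 * (s - L) ≤ 1 / L ^ 6 := by
      calc 1 / L ^ 14 * (s - L) ≤ 1 / L ^ 14 * L ^ 8 := by gcongr; linarith
        _ = 1 / L ^ 6 := by field_simp
    have h2 := hsmall L hL0.le (h.trans hsT) le_rfl
    have h3 := abs_sub_abs_le_abs_sub (y s) (y L)
    have h4 : 49 / L ^ 6 = 48 / L ^ 6 + 1 / L ^ 6 := by ring
    linarith
  have hL2 : L ^ 2 ≤ L ^ 8 := pow_le_pow_right₀ (by linarith) (by norm_num)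
  have hall : |y t| ≤ 359 / L ^ 5 := by
    have h65 : 49 / L ^ 6 ≤ 49 / L ^ 5 := by
      have : L ^ 5 ≤ L ^ 6 := pow_le_pow_right₀ (by linarith) (by norm_num)
      gcongr
    rcases le_total t (L ^ 8 - L) with h | h
    · refine ((hmid t h0 ht h).trans h65).trans ?_
      gcongr
      norm_num
    set t₁ := L ^ 8 - L with ht₁
    have ht₁0 : L ≤ t₁ := by nlinarith
    have ht₁T : t₁ ≤ T := h.trans ht
    have hv₁ : |z t₁ - t₁| ≤ 49 * L ^ 2 := by
      have := S.abs_z_sub_le le_rfl (hL0.le.trans ht₁0) (fun s hs =>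
        hmid s hs.1.le (hs.2.le.trans ht₁T) hs.2.le)
      simp only [S.z_zero, sub_zero] at this
      refine this.trans ?_
      calc 49 / L ^ 6 * t₁ ≤ 49 / L ^ 6 * L ^ 8 := by gcongr; linarith
        _ = 49 * L ^ 2 := by field_simp
    have hy := abs_sub_le_of_hasDerivAt (C := 310 / L ^ 6) h S.contY.continuousOn
      (fun x hx => S.derivY x ((hL0.trans_le ht₁0).trans hx.1)) (fun x hx => by
        have hxL : L < x := ht₁0.trans_lt hx.1
        have hx0 : 0 < x := hL0.trans hxL
        have hxT : x < T := hx.2.trans_le ht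
        refine (S.abs_deriv_le hδ4 (by linarith) hxT).trans ?_
        have hv := S.abs_z_sub_le (hL0.le.trans ht₁0) hx.1.le (fun s hs =>
          S.bound s ⟨(hL0.trans_le ht₁0).trans hs.1, hs.2.trans hxT⟩)
        have hvx : |z x - x| ≤ 50 * L ^ 2 := by
          have h1 : 1 / L ^ 4 * (x - t₁) ≤ 1 * L := by
            gcongr
            · linarith [hx.1]
            · linarith
            · linarith
          have h2 := abs_sub_abs_le_abs_sub (z x - x) (z t₁ - t₁)
          nlinarith
        have hab : |1 - 1 / L ^ 8 * z x| ≤ 51 / L ^ 6 := by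
          have e1 : 1 - 1 / L ^ 8 * z x = ((L ^ 8 - x) - (z x - x)) / L ^ 8 := by
            field_simp; ring
          have e2 : 51 / L ^ 6 = 51 * L ^ 2 / L ^ 8 := by field_simp
          rw [e1, e2, abs_div, abs_of_pos (pow_pos hL0 8)]
          gcongr
          rw [abs_le] at hvx ⊢
          have := hx.1
          constructor <;> nlinarith [hvx.1, hvx.2]
        have hH := S.density_le_three hεδ hδ hδ4 hεT hx0.le hxT.le
        have hH0 : 0 < bubbleDensity (1 / L ^ 8) z x := exp_pos _
        have hprod : |1 - 1 / L ^ 8 * z x| * bubbleDensity (1 / L ^ 8) z x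
            ≤ 51 / L ^ 6 * 3 := by gcongr
        have hxe : exp (-x) ≤ 1 / L ^ 6 := by
          refine (exp_le_exp.2 (by linarith : -x ≤ -(L / 4))).trans (hexp'.trans ?_)
          have : L ^ 6 ≤ L ^ 14 := pow_le_pow_right₀ (by linarith) (by norm_num)
          have : 0 < L ^ 6 := by positivity
          exact one_div_le_one_div_of_le this (by linarith)
        have e3 : 310 / L ^ 6 = 4 * (1 / L ^ 6) + 2 * (51 / L ^ 6 * 3) := by ring
        linarith)
    have h1 : 310 / L ^ 6 * (t - t₁) ≤ 310 / L ^ 5 := by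
      calc 310 / L ^ 6 * (t - t₁) ≤ 310 / L ^ 6 * L := by gcongr; linarith
        _ = 310 / L ^ 5 := by field_simp
    have h2 := hmid t₁ (hL0.le.trans ht₁0) ht₁T le_rfl
    have h3 := abs_sub_abs_le_abs_sub (y t) (y t₁)
    have h4 : 359 / L ^ 5 = 310 / L ^ 5 + 49 / L ^ 5 := by ring
    linarith
  refine hall.trans_lt ?_
  rw [div_lt_div_iff₀ (by positivity) (by positivity)]
  have : 0 < L ^ 4 := by positivity
  nlinarith

end BubbleSystem

/-- The first exit time argument: a solution of the system never leaves `|y| < L⁻⁴`. -/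
theorem abs_lt_of_bubbleSystem {L : ℝ} (hL : 1000 ≤ L)
    (hexp : 10 * L ^ 14 * exp (-(L / 4)) ≤ 1) {z y y' : ℝ → ℝ}
    (S : BubbleSystem (1 / L ^ 8) (1 / L ^ 4) 0 z y y') {t : ℝ} (h0 : 0 ≤ t) (ht : t ≤ L ^ 8) :
    |y t| < 1 / L ^ 4 := by
  by_contra! hcon
  have hcY := S.contY
  have hK : IsCompact (Icc 0 t ∩ {s | 1 / L ^ 4 ≤ |y s|}) :=
    isCompact_Icc.inter_right (isClosed_le continuous_const hcY.abs)
  obtain ⟨T, ⟨hT, hyT⟩, hmin⟩ := hK.exists_isLeast ⟨t, ⟨h0, le_rfl⟩, hcon⟩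
  have S' : BubbleSystem (1 / L ^ 8) (1 / L ^ 4) T z y y' :=
    { S with
      bound := fun s hs => by
        by_contra! hlt
        exact absurd (hmin ⟨⟨hs.1.le, hs.2.le.trans hT.2⟩, hlt.le⟩) (not_le.2 hs.2) }
  exact absurd (S'.abs_y_lt hL hexp (hT.2.trans ht) hT.1 le_rfl) (not_lt.2 hyT)

/-- The radius `r(t) = 2μ√(eᵗ - 1)` as a function of the logarithmic variable. -/
def bubbleRadius (μ t : ℝ) : ℝ := 2 * μ * sqrt (exp t - 1)

theorem bubbleRadius_pos {μ t : ℝ} (hμ : 0 < μ) (ht : 0 < t) : 0 < bubbleRadius μ t := by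
  have : 0 < exp t - 1 := sub_pos.2 (one_lt_exp_iff.2 ht)
  unfold bubbleRadius
  positivity

theorem bubbleRadius_sq {μ t : ℝ} (ht : 0 ≤ t) :
    bubbleRadius μ t ^ 2 = 4 * μ ^ 2 * (exp t - 1) := by
  have : 0 ≤ exp t - 1 := sub_nonneg.2 (one_le_exp ht)
  rw [bubbleRadius, mul_pow, sq_sqrt this]
  ring

theorem hasDerivAt_bubbleRadius {μ t : ℝ} (hμ : 0 < μ) (ht : 0 < t) :
    HasDerivAt (bubbleRadius μ) (2 * μ ^ 2 * exp t / bubbleRadius μ t) t := by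
  have h : 0 < exp t - 1 := sub_pos.2 (one_lt_exp_iff.2 ht)
  have hs : 0 < sqrt (exp t - 1) := sqrt_pos.2 h
  have := (((Real.hasDerivAt_exp t).sub_const 1).sqrt h.ne').const_mul (2 * μ)
  refine this.congr_deriv ?_
  rw [bubbleRadius]
  field_simp

/-- In the variables `z = γ (γ - b)`, `y = z' - 1` the bubble equation is a `BubbleSystem`. -/
theorem bubbleSystem_of_bubble {γ μ : ℝ} (hγ : 0 < γ) (hμ : 0 < μ) {B : ℝ → ℝ}
    (hB : ContDiff ℝ (⊤ : ℕ∞) B) (hB0 : B 0 = γ) (hB1 : deriv B 0 = 0)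
    (hode : ∀ r > (0 : ℝ), deriv (deriv B) r + deriv B r / r
      = -((μ ^ 2)⁻¹ * (γ ^ 2)⁻¹ * B r * Real.exp ((B r) ^ 2 - γ ^ 2))) (δ : ℝ) :
    ∃ z y y' : ℝ → ℝ, BubbleSystem (1 / γ ^ 2) δ 0 z y y' ∧
      ∀ t, 0 < t → HasDerivAt (fun τ => B (2 * μ * sqrt (exp τ - 1))) (-(1 + y t) / γ) t := by
  have hBd : Differentiable ℝ B := hB.differentiable (by simp)
  have hB' : ContDiff ℝ (⊤ : ℕ∞) (deriv B) := (contDiff_infty_iff_deriv.1 hB).2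
  have hBd' : Differentiable ℝ (deriv B) := hB'.differentiable (by simp)
  have hBc'' : Continuous (deriv (deriv B)) := ((contDiff_infty_iff_deriv.1 hB').2).continuous
  have hcD : Continuous (dslope (deriv B) 0) := by
    rw [continuous_iff_continuousAt]
    intro x
    rcases eq_or_ne x 0 with rfl | hx
    · exact continuousAt_dslope_same.2 (hBd' 0)
    · exact (continuousAt_dslope_of_ne hx).2 (hBd' x).continuousAt
  have hD : ∀ r, r ≠ 0 → dslope (deriv B) 0 r = deriv B r / r := by
    intro r hr
    rw [dslope_of_ne _ hr, slope_def_field, hB1, sub_zero, sub_zero]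
  have hD0 : dslope (deriv B) 0 0 = deriv (deriv B) 0 := dslope_same _ _
  have hB2 : 2 * deriv (deriv B) 0 = -((μ ^ 2)⁻¹ * γ⁻¹) := by
    have hBc := hBd.continuous
    have hE : EqOn (fun r => deriv (deriv B) r + dslope (deriv B) 0 r)
        (fun r => -((μ ^ 2)⁻¹ * (γ ^ 2)⁻¹ * B r * Real.exp ((B r) ^ 2 - γ ^ 2)))
        (closure (Ioi 0)) := by
      refine EqOn.closure (fun r hr => ?_) (hBc''.add hcD) (by fun_prop)
      have hr' : (0 : ℝ) < r := hr
      simp only [hD r hr'.ne', hode r hr']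
    have := hE (x := 0) (by rw [closure_Ioi]; simp)
    simp only [hD0, hB0, sub_self, exp_zero, mul_one] at this
    rw [two_mul, this]
    field_simp
  have hrc : Continuous (bubbleRadius μ) := by
    unfold bubbleRadius
    fun_prop
  have hr0 : bubbleRadius μ 0 = 0 := by simp [bubbleRadius]
  have hYval : ∀ t, 0 < t →
      -(2 * γ * μ ^ 2) * exp t * dslope (deriv B) 0 (bubbleRadius μ t) - 1
        = -(2 * γ * μ ^ 2) * exp t * (deriv B (bubbleRadius μ t) / bubbleRadius μ t) - 1 := by
    intro t ht
    rw [hD _ (bubbleRadius_pos hμ ht).ne']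
  have hb : ∀ t, 0 < t → HasDerivAt (fun τ => B (bubbleRadius μ τ))
      (deriv B (bubbleRadius μ t) * (2 * μ ^ 2 * exp t / bubbleRadius μ t)) t := fun t ht =>
    (hBd _).hasDerivAt.comp t (hasDerivAt_bubbleRadius hμ ht)
  refine ⟨fun t => γ * (γ - B (bubbleRadius μ t)),
    fun t => -(2 * γ * μ ^ 2) * exp t * dslope (deriv B) 0 (bubbleRadius μ t) - 1,
    fun t => -(2 * γ * μ ^ 2) * (exp t * (deriv B (bubbleRadius μ t) / bubbleRadius μ t)
      + exp t * ((deriv (deriv B) (bubbleRadius μ t) * (2 * μ ^ 2 * exp t / bubbleRadius μ t)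
        * bubbleRadius μ t - deriv B (bubbleRadius μ t)
          * (2 * μ ^ 2 * exp t / bubbleRadius μ t)) / bubbleRadius μ t ^ 2)),
    ⟨?_, ?_, ?_, ?_, ?_, ?_, ?_, ?_⟩, ?_⟩
  · have := hBd.continuous
    fun_prop
  · fun_prop
  · simp [hr0, hB0]
  · simp only [hr0, hD0, exp_zero]
    have : deriv (deriv B) 0 = -((μ ^ 2)⁻¹ * γ⁻¹) / 2 := by linarith
    rw [this]
    field_simp
    ring
  · intro t ht
    refine (((hb t ht).const_sub γ).const_mul γ).congr_deriv ?_
    rw [hYval t ht]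
    ring
  · intro t ht
    have hr := bubbleRadius_pos hμ ht
    have h1 : HasDerivAt (fun τ => deriv B (bubbleRadius μ τ))
        (deriv (deriv B) (bubbleRadius μ t) * (2 * μ ^ 2 * exp t / bubbleRadius μ t)) t :=
      (hBd' _).hasDerivAt.comp t (hasDerivAt_bubbleRadius hμ ht)
    have h2 := (((Real.hasDerivAt_exp t).mul
      (h1.div (hasDerivAt_bubbleRadius hμ ht) hr.ne')).const_mul (-(2 * γ * μ ^ 2))).sub_const 1
    refine h2.congr_of_eventuallyEq ?_
    filter_upwards [lt_mem_nhds ht] with s hs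
    rw [hYval s hs]
    simp only [Pi.mul_apply, Pi.div_apply]
    ring
  · intro t ht
    have hr := bubbleRadius_pos hμ ht
    have hr2 := bubbleRadius_sq (μ := μ) ht.le
    have ho := hode _ hr
    rw [hYval t ht, bubbleDensity]
    set r := bubbleRadius μ t
    have e1 : t - 2 * (γ * (γ - B r)) + 1 / γ ^ 2 * (γ * (γ - B r)) ^ 2
        = t + (B r ^ 2 - γ ^ 2) := by field_simp; ring
    rw [e1, exp_add]
    set E := exp (B r ^ 2 - γ ^ 2)
    have e2 : deriv (deriv B) r = -((μ ^ 2)⁻¹ * (γ ^ 2)⁻¹ * B r * E) - deriv B r / r := by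
      linarith
    rw [e2, exp_neg]
    have hx : exp t = r ^ 2 / (4 * μ ^ 2) + 1 := by
      rw [hr2]; field_simp; ring
    have hx0 : 0 < r ^ 2 / (4 * μ ^ 2) + 1 := by positivity
    rw [hx]
    have hx1 : r ^ 2 + 4 * μ ^ 2 ≠ 0 := by positivity
    field_simp
    ring
  · intro t ht
    exact absurd ht (by simp)
  · intro t ht
    refine (hb t ht).congr_deriv ?_
    beta_reduce
    rw [hYval t ht]
    field_simp
    ring

/-- **derivative estimate for the standard bubble in the logarithmic
radial variable `t = ln(1 + r²/(4μ²))`, i.e. `b(t) = B(2μ√(eᵗ − 1))`.** -/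
theorem stmt19 :
    ∃ C₁ : ℝ, 0 < C₁ ∧ ∃ γ₀ : ℝ, 0 < γ₀ ∧
      ∀ γ : ℝ, γ₀ ≤ γ → ∀ μ : ℝ, 0 < μ → ∀ B : ℝ → ℝ,
        ContDiff ℝ (⊤ : ℕ∞) B → B 0 = γ → deriv B 0 = 0 →
        (∀ r > (0 : ℝ), deriv (deriv B) r + deriv B r / r
          = -((μ ^ 2)⁻¹ * (γ ^ 2)⁻¹ * B r * Real.exp ((B r) ^ 2 - γ ^ 2))) →
        ∀ t : ℝ, 0 < t → t ≤ γ ^ 2 →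
          |deriv (fun τ => B (2 * μ * Real.sqrt (Real.exp τ - 1))) t + γ⁻¹| ≤ C₁ / γ ^ 2 := by
  have hev : ∀ᶠ L : ℝ in atTop, 10 * L ^ 14 * exp (-(L / 4)) ≤ 1 := by
    have h1 := (tendsto_pow_mul_exp_neg_atTop_nhds_zero 14).comp
      (tendsto_id.atTop_div_const (by norm_num : (0 : ℝ) < 4))
    have h2 := h1.const_mul (10 * 4 ^ 14)
    rw [mul_zero] at h2
    filter_upwards [h2.eventually (ge_mem_nhds one_pos)] with L hL
    simp only [Function.comp_apply, id_eq] at hL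
    calc 10 * L ^ 14 * exp (-(L / 4)) = 10 * 4 ^ 14 * ((L / 4) ^ 14 * exp (-(L / 4))) := by ring
      _ ≤ 1 := hL
  obtain ⟨L₀, hL₀⟩ := eventually_atTop.1 hev
  refine ⟨1, one_pos, (max L₀ 1000) ^ 4, by positivity, ?_⟩
  intro γ hγ μ hμ B hB hB0 hB1 hode t ht htγ
  have hγ0 : 0 < γ := lt_of_lt_of_le (by positivity) hγ
  obtain ⟨L, hL0, hLγ⟩ : ∃ L : ℝ, 0 ≤ L ∧ L ^ 4 = γ :=
    ⟨sqrt (sqrt γ), by positivity, by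
      rw [show (4 : ℕ) = 2 * 2 from rfl, pow_mul, sq_sqrt (by positivity), sq_sqrt hγ0.le]⟩
  have hLm : max L₀ 1000 ≤ L := by
    rw [← hLγ] at hγ
    exact (pow_le_pow_iff_left₀ (by positivity) hL0 (by norm_num)).1 hγ
  have hL8 : γ ^ 2 = L ^ 8 := by rw [← hLγ]; ring
  obtain ⟨z, y, y', S, hbd⟩ := bubbleSystem_of_bubble hγ0 hμ hB hB0 hB1 hode (1 / L ^ 4)
  rw [hL8] at S htγ
  have hy := abs_lt_of_bubbleSystem ((le_max_right _ _).trans hLm)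
    (hL₀ L ((le_max_left _ _).trans hLm)) S ht.le htγ
  rw [(hbd t ht).deriv]
  rw [hLγ] at hy
  have e : -(1 + y t) / γ + γ⁻¹ = -(y t) / γ := by field_simp; ring
  rw [e, abs_div, abs_neg, abs_of_pos hγ0, div_le_div_iff₀ hγ0 (by positivity)]
  rw [lt_div_iff₀ hγ0] at hy
  nlinarith

end
end
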